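/- arXiv:2112.03729 — 2 statements merged into one kernel-verified Lean document; each statement's English description precedes it below -/
import Mathlib

section
/- Let j be a positive integer, let n ≥ 2(j+1), and let g be a zonal function on 𝕊^{n−1} of class C^j (identified with a function ḡ ∈ C^j([−1,1])). Then for all k ≥ 0, a_kⁿ[ḡ^{(j)}] = (2π)^j · a_{k+j}^{n−2j}[ḡ], where ḡ^{(j)} is the j-th derivative of ḡ. -/
open scoped InnerProductSpace Pointwise
open MeasureTheory Metric Filter Topology

noncomputable section

/-- Euclidean space `ℝⁿ`. -/
abbrev En (n : ℕ) := EuclideanSpace ℝ (Fin n)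

namespace MinkIter

variable {n : ℕ}

/-- The unit sphere `𝕊^{n-1}` as a subtype. -/
abbrev Sph (n : ℕ) := Metric.sphere (0 : En n) 1

/-- Spherical Lebesgue measure on `𝕊^{n-1}`. -/
def sphVol (n : ℕ) : Measure (Sph n) := (volume : Measure (En n)).toSphere

/-- A fixed pole `ē ∈ 𝕊^{n-1}`. -/
def pole (n : ℕ) : En n :=
  if h : 0 < n then EuclideanSpace.single (⟨0, h⟩ : Fin n) 1 else 0

/-- The support function of a convex body, as a function on all of `ℝⁿ`. -/
def supp (K : ConvexBody (En n)) (x : En n) : ℝ :=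
  sSup ((fun y => ⟪x, y⟫_ℝ) '' (K : Set (En n)))

/-- The Euclidean unit ball `𝔹ⁿ` as a convex body. -/
def ballB (n : ℕ) : ConvexBody (En n) :=
  ⟨closedBall 0 1, convex_closedBall 0 1, isCompact_closedBall 0 1, ⟨0, by simp⟩⟩

/-- The dilate `c • K` of a convex body. -/
def scale (c : ℝ) (K : ConvexBody (En n)) : ConvexBody (En n) :=
  ⟨c • (K : Set (En n)), K.convex.smul c, K.isCompact.smul c, K.nonempty.smul_set⟩

/-- The translate `K + x` of a convex body. -/
def translate (K : ConvexBody (En n)) (x : En n) : ConvexBody (En n) :=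
  ⟨(fun y => x + y) '' (K : Set (En n)), K.convex.translate x,
    K.isCompact.image (continuous_add_left x), K.nonempty.image _⟩

/-- A linear isometry of `ℝⁿ` is a rotation (element of `SO(n)`) if it preserves
orientation. -/
def IsRotation (ρ : En n ≃ₗᵢ[ℝ] En n) : Prop :=
  0 < LinearMap.det (ρ.toLinearEquiv.toLinearMap)

/-- The image `ρ K` of a convex body under a linear isometry. -/
def rotate (ρ : En n ≃ₗᵢ[ℝ] En n) (K : ConvexBody (En n)) : ConvexBody (En n) :=
  ⟨ρ '' (K : Set (En n)), K.convex.linear_image ρ.toLinearEquiv.toLinearMap,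
    K.isCompact.image ρ.continuous, K.nonempty.image _⟩

/-- `Φ` is a Minkowski valuation: `ΦK + ΦL = Φ(K ∪ L) + Φ(K ∩ L)` whenever `K ∪ L`
is convex (Minkowski addition on the left). -/
def IsMinkowskiValuation (Φ : ConvexBody (En n) → ConvexBody (En n)) : Prop :=
  ∀ (K L : ConvexBody (En n)) (hu : Convex ℝ ((K : Set (En n)) ∪ (L : Set (En n))))
    (hi : ((K : Set (En n)) ∩ (L : Set (En n))).Nonempty),
    Φ K + Φ L =
      Φ ⟨(K : Set (En n)) ∪ (L : Set (En n)), hu, K.isCompact.union L.isCompact,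
          K.nonempty.inl⟩ +
      Φ ⟨(K : Set (En n)) ∩ (L : Set (En n)), K.convex.inter L.convex,
          K.isCompact.inter_right L.isCompact.isClosed, hi⟩

/-- `Φ` is translation invariant. -/
def TranslationInvariant (Φ : ConvexBody (En n) → ConvexBody (En n)) : Prop :=
  ∀ (K : ConvexBody (En n)) (x : En n), Φ (translate K x) = Φ K

/-- `Φ` is (positively) homogeneous of degree `i`. -/
def HasDegree (i : ℕ) (Φ : ConvexBody (En n) → ConvexBody (En n)) : Prop :=
  ∀ (K : ConvexBody (En n)) (c : ℝ), 0 ≤ c → Φ (scale c K) = scale (c ^ i) (Φ K)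

/-- `Φ` commutes with `SO(n)`. -/
def RotationEquivariant (Φ : ConvexBody (En n) → ConvexBody (En n)) : Prop :=
  ∀ ρ : En n ≃ₗᵢ[ℝ] En n, IsRotation ρ → ∀ K, Φ (rotate ρ K) = rotate ρ (Φ K)

/-- `Φ` is even: `Φ(-K) = ΦK`. -/
def IsEven (Φ : ConvexBody (En n) → ConvexBody (En n)) : Prop :=
  ∀ K, Φ (scale (-1) K) = Φ K

/-- `Φ` is monotone w.r.t. set inclusion. -/
def MonotoneVal (Φ : ConvexBody (En n) → ConvexBody (En n)) : Prop :=
  ∀ K L : ConvexBody (En n), (K : Set (En n)) ⊆ (L : Set (En n)) →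
    (Φ K : Set (En n)) ⊆ (Φ L : Set (En n))

/-- `Φ` is non-trivial: `ΦK ≠ {o}` for some `K`. -/
def NontrivialVal (Φ : ConvexBody (En n) → ConvexBody (En n)) : Prop :=
  ∃ K : ConvexBody (En n), (Φ K : Set (En n)) ≠ {0}

/-- The mixed volume `V(K₁,…,Kₙ)`, via polarization of the volume. -/
def mixedVol (Ks : Fin n → ConvexBody (En n)) : ℝ :=
  ((n.factorial : ℝ))⁻¹ *
    ∑ S : Finset (Fin n), (-1 : ℝ) ^ (n - S.card) *
      (volume ((∑ k ∈ S, Ks k : ConvexBody (En n)) : Set (En n))).toReal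

/-- `κ_m`, the volume of the `m`-dimensional unit ball. -/
def kappa (m : ℕ) : ℝ := (volume (closedBall (0 : En m) 1)).toReal

/-- `ω_m`, the surface area of the `m`-dimensional unit ball. -/
def omegaS (m : ℕ) : ℝ := m * kappa m

/-- The `j`-th intrinsic volume `V_j(K) = binom(n,j) V(K[j],𝔹ⁿ[n-j]) / κ_{n-j}`. -/
def intrinsicVol (j : ℕ) (K : ConvexBody (En n)) : ℝ :=
  (n.choose j : ℝ) / kappa (n - j) *
    mixedVol (fun k : Fin n => if (k : ℕ) < j then K else ballB n)

/-- `μ` is the area measure of order `i` of `K`: for every convex body `L`,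
`∫ h_L dμ = n V(L, K[i], 𝔹ⁿ[n-1-i])`. -/
def IsAreaMeasure (i : ℕ) (K : ConvexBody (En n)) (μ : Measure (Sph n)) : Prop :=
  ∀ L : ConvexBody (En n),
    (∫ v : Sph n, supp L (v : En n) ∂μ) =
      n * mixedVol (fun k : Fin n =>
        if (k : ℕ) = 0 then L else if (k : ℕ) ≤ i then K else ballB n)

/-- `Φ` is generated by the zonal function with profile `g : [-1,1] → ℝ`, i.e.
`h_{ΦK} = S_i(K,·) ∗ g` where `∗` is the spherical convolution. -/
def GeneratedBy (i : ℕ) (Φ : ConvexBody (En n) → ConvexBody (En n)) (g : ℝ → ℝ) : Prop :=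
  ∀ (K : ConvexBody (En n)) (μ : Measure (Sph n)), IsAreaMeasure i K μ →
    ∀ u : En n, ‖u‖ = 1 →
      supp (Φ K) u = ∫ v : Sph n, g ⟪u, (v : En n)⟫_ℝ ∂μ

/-- `L` is a body of revolution: invariant under all rotations fixing the pole. -/
def IsZonalBody (L : ConvexBody (En n)) : Prop :=
  ∀ ρ : En n ≃ₗᵢ[ℝ] En n, IsRotation ρ → ρ (pole n) = pole n → rotate ρ L = L

/-- The quadratic form of the Hessian of `F` at `u` in direction `w`. -/
def hessQ (F : En n → ℝ) (u w : En n) : ℝ := iteratedFDeriv ℝ 2 F u ![w, w]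

/-- `(j,l)` entry of the Hessian of `F` at `u`. -/
def hessE (F : En n → ℝ) (u : En n) (j l : Fin n) : ℝ :=
  iteratedFDeriv ℝ 2 F u ![EuclideanSpace.single j 1, EuclideanSpace.single l 1]

/-- A convex body is of class `C^k₊` if its support function is of class `C^k`
away from the origin and the restriction of its Hessian to `u^⊥` is positive
definite for every unit vector `u`. -/
def IsCkPlus (k : ℕ∞) (L : ConvexBody (En n)) : Prop :=
  ContDiffOn ℝ k (supp L) {0}ᶜ ∧
    ∀ u : En n, ‖u‖ = 1 → ∀ w : En n, w ≠ 0 → ⟪u, w⟫_ℝ = 0 → 0 < hessQ (supp L) u w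

/-- `Φ` is a `C^∞₊` regular Minkowski valuation of degree `i`: it is generated by
the support function of a body of revolution of class `C^∞₊`. -/
def CInfRegular (i : ℕ) (Φ : ConvexBody (En n) → ConvexBody (En n)) : Prop :=
  ∃ (L : ConvexBody (En n)) (g : ℝ → ℝ), IsZonalBody L ∧ IsCkPlus ⊤ L ∧
    (∀ u : En n, ‖u‖ = 1 → supp L u = g ⟪u, pole n⟫_ℝ) ∧ GeneratedBy i Φ g

/-- The `C²(𝕊^{n-1})` distance of two functions. -/
def C2dist (F G : En n → ℝ) : ℝ :=
  ⨆ u : Sph n, (|F (u : En n) - G (u : En n)| +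
    ‖fderiv ℝ F (u : En n) - fderiv ℝ G (u : En n)‖ +
    ‖iteratedFDeriv ℝ 2 F (u : En n) - iteratedFDeriv ℝ 2 G (u : En n)‖)

/-- The Legendre polynomial of dimension `d` and degree `k` (Rodrigues formula). -/
def legendreP (d k : ℕ) (t : ℝ) : ℝ :=
  (-1 : ℝ) ^ k *
    (Real.Gamma (((d : ℝ) - 1) / 2) / (2 ^ k * Real.Gamma (((d : ℝ) - 1) / 2 + k))) *
    (1 - t ^ 2) ^ (-(((d : ℝ) - 3) / 2)) *
    iteratedDeriv k (fun s : ℝ => (1 - s ^ 2) ^ ((((d : ℝ) - 3) / 2) + (k : ℝ))) t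

/-- The multiplier `a_k^d[h]` of a zonal function with profile `h : [-1,1] → ℝ`. -/
def multInt (d k : ℕ) (h : ℝ → ℝ) : ℝ :=
  omegaS (d - 1) *
    ∫ t in (-1 : ℝ)..1, legendreP d k t * h t * (1 - t ^ 2) ^ (((d : ℝ) - 3) / 2)

/-- The multiplier `a_k^n[f] = ∫_{𝕊^{n-1}} f(u) P_k^n(ē·u) du` of a zonal function
`f` on the sphere. -/
def multSph (k : ℕ) (f : En n → ℝ) : ℝ :=
  ∫ u : Sph n, f (u : En n) * legendreP n k ⟪pole n, (u : En n)⟫_ℝ ∂(sphVol n)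

/-- The projection `π₀ f` of `f` onto the constants (its mean value). -/
def proj0 (f : En n → ℝ) : ℝ :=
  (omegaS n)⁻¹ * ∫ u : Sph n, f (u : En n) ∂(sphVol n)

/-- The `L²(𝕊^{n-1})` norm. -/
def sphL2 (f : En n → ℝ) : ℝ :=
  Real.sqrt (∫ u : Sph n, (f (u : En n)) ^ 2 ∂(sphVol n))

/-- The sup norm on the sphere. -/
def supSph (f : En n → ℝ) : ℝ := ⨆ u : Sph n, |f (u : En n)|

/-- `M ∈ UBounds α f` iff `M` witnesses `‖f‖_{𝒰_α} ≤ M`: `‖f‖_∞ ≤ M` and for every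
`k ≥ 1` there is a polynomial of degree at most `k` with `‖f - p_k‖_{L²} ≤ M k^{-α}`. -/
def UBounds (α : ℝ) (f : En n → ℝ) : Set ℝ :=
  {M | (∀ u : En n, ‖u‖ = 1 → |f u| ≤ M) ∧
    ∀ k : ℕ, 0 < k → ∃ p : MvPolynomial (Fin n) ℝ, p.totalDegree ≤ k ∧
      sphL2 (fun x => f x - MvPolynomial.eval (fun j => x j) p) ≤ M * (k : ℝ) ^ (-α)}

/-- `f ∈ 𝒰_α`. -/
def MemU (α : ℝ) (f : En n → ℝ) : Prop := (UBounds α f).Nonempty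

/-- The norm `‖f‖_{𝒰_α}`. -/
def UNorm (α : ℝ) (f : En n → ℝ) : ℝ := sInf (UBounds α f)

/-- The convolution transform `T_g f` with zonal kernel of profile `g`, extended
1-homogeneously to `ℝⁿ`: `(T_g f)(u) = ∫_{𝕊^{n-1}} g(u·v) f(v) dv` for unit `u`. -/
def Tg (g : ℝ → ℝ) (f : En n → ℝ) (x : En n) : ℝ :=
  ‖x‖ * ∫ v : Sph n, g ⟪‖x‖⁻¹ • x, (v : En n)⟫_ℝ * f (v : En n) ∂(sphVol n)

/-- The 0-homogeneous extension of a function on the sphere. -/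
def zeroExt (f : En n → ℝ) (x : En n) : ℝ := f (‖x‖⁻¹ • x)

/-- The spherical Laplacian `Δ_𝕊 f`, i.e. the Euclidean Laplacian of the
0-homogeneous extension. -/
def sphLap (f : En n → ℝ) (u : En n) : ℝ := ∑ j : Fin n, hessE (zeroExt f) u j j

/-- The operator `□_n f = f + Δ_𝕊 f /(n-1)`. -/
def boxN (f : En n → ℝ) (u : En n) : ℝ := f u + ((n : ℝ) - 1)⁻¹ * sphLap f u

/-- The mixed discriminant of `m` symmetric `m × m` matrices, via polarization of
the determinant. -/
def mixedDisc {m : ℕ} (A : Fin m → Matrix (Fin m) (Fin m) ℝ) : ℝ :=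
  ((m.factorial : ℝ))⁻¹ *
    ∑ S : Finset (Fin m), (-1 : ℝ) ^ (m - S.card) * (∑ k ∈ S, A k).det

/-- The rank one matrix `u ⊗ u`. -/
def outer (u : En n) : Matrix (Fin n) (Fin n) ℝ := Matrix.of fun j l => u j * u l

/-- The matrix of the orthogonal projection onto `u^⊥`. -/
def projMat (u : En n) : Matrix (Fin n) (Fin n) ℝ := 1 - outer u

/-- The Hessian matrix of `F` at `u`. -/
def hessMat (F : En n → ℝ) (u : En n) : Matrix (Fin n) (Fin n) ℝ :=
  Matrix.of fun j l => hessE F u j l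

/-- The mixed discriminant `D_{n-1}(B₁|_{u^⊥},…,B_{n-1}|_{u^⊥})` of the restrictions
to `u^⊥` of matrices annihilating `u`, computed via the identity
`D_{n-1}(B₁|_{u^⊥},…) = n · D_n(u ⊗ u, B₁,…,B_{n-1})`. -/
def restrDisc (u : En n) (B : Fin (n - 1) → Matrix (Fin n) (Fin n) ℝ) : ℝ :=
  n * mixedDisc (fun k : Fin n =>
    if h : (k : ℕ) = 0 then outer u else B ⟨(k : ℕ) - 1, by have := k.isLt; omega⟩)

/-- Total variation distance between two Borel measures on the sphere. -/
def dTV (μ ν : Measure (Sph n)) : ℝ :=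
  ⨆ A : {A : Set (Sph n) // MeasurableSet A}, |(μ A).toReal - (ν A).toReal|

/-- Lévy–Prokhorov distance between two Borel measures on the sphere. -/
def dLP (μ ν : Measure (Sph n)) : ℝ :=
  sInf {ε : ℝ | 0 < ε ∧ ∀ A : Set (Sph n), MeasurableSet A →
    μ A ≤ ν (Metric.thickening ε A) + ENNReal.ofReal ε ∧
    ν A ≤ μ (Metric.thickening ε A) + ENNReal.ofReal ε}

/-- Two convex bodies are homothetic: one is a translate of a positive dilate of
the other. -/
def Homothetic (K L : ConvexBody (En n)) : Prop :=
  ∃ (c : ℝ) (x : En n), 0 < c ∧ (L : Set (En n)) = x +ᵥ c • (K : Set (En n))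

/-- The dimension of a convex body (dimension of its affine hull). -/
def bodyDim (K : ConvexBody (En n)) : ℕ :=
  Module.finrank ℝ (vectorSpan ℝ (K : Set (En n)))

/-- `K` is a Euclidean ball. -/
def IsBall (K : ConvexBody (En n)) : Prop :=
  ∃ (c : En n) (r : ℝ), 0 < r ∧ (K : Set (En n)) = closedBall c r

/-- The mean width `w(K) = (2/ω_n) ∫_{𝕊^{n-1}} h_K`. -/
def meanWidth (K : ConvexBody (En n)) : ℝ :=
  2 / omegaS n * ∫ u : Sph n, supp K (u : En n) ∂(sphVol n)

/-- `N(n,k)`, the dimension of the space of spherical harmonics of dimension `n`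
and degree `k`. -/
def Nnk (n k : ℕ) : ℝ :=
  (((n : ℝ) + 2 * k - 2) / ((n : ℝ) + k - 2)) * (Nat.choose (n + k - 2) (n - 2) : ℝ)

/-- The power `(1 - t²)^γ` is integrable on `[-1, 1]` for `γ > -1`. -/
lemma intervalIntegrable_one_sub_sq_rpow {γ : ℝ} (hγ : -1 < γ) :
    IntervalIntegrable (fun t : ℝ => (1 - t ^ 2) ^ γ) volume (-1) 1 := by
  have hright : IntervalIntegrable (fun t : ℝ => (1 - t ^ 2) ^ γ) volume 0 1 := by
    have h1 : IntervalIntegrable (fun t : ℝ => (1 - t) ^ γ) volume 0 1 := by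
      have h := (intervalIntegral.intervalIntegrable_rpow' (a := 1) (b := 0) hγ).comp_sub_left 1
      simpa using h
    have h2 : ContinuousOn (fun t : ℝ => (1 + t) ^ γ) (Set.uIcc 0 1) := by
      refine ContinuousOn.rpow_const (by fun_prop) fun t ht => Or.inl ?_
      rw [Set.uIcc_of_le zero_le_one] at ht
      linarith [ht.1]
    refine (h1.mul_continuousOn h2).congr_uIoo fun t ht => ?_
    rw [Set.uIoo_of_le zero_le_one] at ht
    change (1 - t) ^ γ * (1 + t) ^ γ = (1 - t ^ 2) ^ γ
    rw [← Real.mul_rpow (by linarith [ht.2]) (by linarith [ht.1])]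
    ring_nf
  refine IntervalIntegrable.trans (b := 0) ?_ hright
  have h := (IntervalIntegrable.iff_comp_neg (by finiteness)).mp hright
  simpa using h.symm

/-- On `(-1, 1)`, the derivatives of `(1 - s²)^α` are polynomial multiples of powers of
`1 - s²`. -/
lemma exists_polynomial_iteratedDeriv_one_sub_sq_rpow (α : ℝ) (m : ℕ) :
    ∃ p : Polynomial ℝ, ∀ t ∈ Set.Ioo (-1 : ℝ) 1,
      iteratedDeriv m (fun s : ℝ => (1 - s ^ 2) ^ α) t = p.eval t * (1 - t ^ 2) ^ (α - m) := by
  induction m with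
  | zero => exact ⟨1, fun t _ => by simp⟩
  | succ m ih =>
    obtain ⟨p, hp⟩ := ih
    refine ⟨Polynomial.derivative p * (1 - Polynomial.X ^ 2) -
      Polynomial.C (2 * (α - m)) * Polynomial.X * p, fun t ht => ?_⟩
    have hpos : 0 < 1 - t ^ 2 := by nlinarith [ht.1, ht.2]
    have hev : iteratedDeriv m (fun s : ℝ => (1 - s ^ 2) ^ α) =ᶠ[𝓝 t]
        fun s => p.eval s * (1 - s ^ 2) ^ (α - m) := by
      filter_upwards [Ioo_mem_nhds ht.1 ht.2] with s hs using hp s hs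
    have hbase : HasDerivAt (fun s : ℝ => 1 - s ^ 2) (-(2 * t)) t := by
      simpa using (hasDerivAt_pow 2 t).const_sub 1
    have hd := (p.hasDerivAt t).mul (hbase.rpow_const (p := α - m) (Or.inl hpos.ne'))
    rw [iteratedDeriv_succ, hev.deriv_eq]
    refine hd.deriv.trans ?_
    have hsplit : (1 - t ^ 2) ^ (α - m) = (1 - t ^ 2) ^ (α - m - 1) * (1 - t ^ 2) := by
      rw [← Real.rpow_add_one hpos.ne']
      ring_nf
    have hexp : α - ((m + 1 : ℕ) : ℝ) = α - m - 1 := by push_cast; ring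
    rw [hexp, hsplit]
    simp
    ring

/-- Integration by parts against a derivative of `(1 - s²)^α` that vanishes at `±1`. -/
lemma integral_iteratedDeriv_mul_succ {α : ℝ} {m l N : ℕ} (hα : (m : ℝ) < α) (hl : l < N)
    {g : ℝ → ℝ} (hg : ContDiffOn ℝ N g (Set.Icc (-1) 1)) :
    ∫ t in (-1 : ℝ)..1, iteratedDeriv m (fun s : ℝ => (1 - s ^ 2) ^ α) t *
        iteratedDerivWithin (l + 1) g (Set.Icc (-1) 1) t =
      -∫ t in (-1 : ℝ)..1, iteratedDeriv (m + 1) (fun s : ℝ => (1 - s ^ 2) ^ α) t *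
        iteratedDerivWithin l g (Set.Icc (-1) 1) t := by
  obtain ⟨p, hp⟩ := exists_polynomial_iteratedDeriv_one_sub_sq_rpow α m
  obtain ⟨q, hq⟩ := exists_polynomial_iteratedDeriv_one_sub_sq_rpow α (m + 1)
  have hle : (-1 : ℝ) ≤ 1 := by norm_num
  have huniq : UniqueDiffOn ℝ (Set.Icc (-1 : ℝ) 1) := uniqueDiffOn_Icc (by norm_num)
  have hu : ContinuousOn (fun t : ℝ => p.eval t * (1 - t ^ 2) ^ (α - m)) (Set.uIcc (-1) 1) :=
    p.continuous.continuousOn.mul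
      (ContinuousOn.rpow_const (by fun_prop) fun t _ => Or.inr (by linarith))
  have hv : ContinuousOn (iteratedDerivWithin l g (Set.Icc (-1) 1)) (Set.uIcc (-1) 1) := by
    rw [Set.uIcc_of_le hle]
    exact hg.continuousOn_iteratedDerivWithin (by exact_mod_cast hl.le) huniq
  have hv' : IntervalIntegrable (iteratedDerivWithin (l + 1) g (Set.Icc (-1) 1))
      volume (-1) 1 := by
    refine ContinuousOn.intervalIntegrable ?_
    rw [Set.uIcc_of_le hle]
    exact hg.continuousOn_iteratedDerivWithin (by exact_mod_cast hl) huniq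
  have huu' : ∀ t ∈ Set.Ioo (min (-1 : ℝ) 1) (max (-1) 1),
      HasDerivAt (fun t : ℝ => p.eval t * (1 - t ^ 2) ^ (α - m))
        (iteratedDeriv (m + 1) (fun s : ℝ => (1 - s ^ 2) ^ α) t) t := by
    rw [min_eq_left hle, max_eq_right hle]
    intro t ht
    have hpos : 0 < 1 - t ^ 2 := by nlinarith [ht.1, ht.2]
    have hev : iteratedDeriv m (fun s : ℝ => (1 - s ^ 2) ^ α) =ᶠ[𝓝 t]
        fun s => p.eval s * (1 - s ^ 2) ^ (α - m) := by
      filter_upwards [Ioo_mem_nhds ht.1 ht.2] with s hs using hp s hs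
    rw [iteratedDeriv_succ, hev.deriv_eq]
    refine DifferentiableAt.hasDerivAt (p.differentiableAt.mul ?_)
    exact DifferentiableAt.rpow_const (by fun_prop) (Or.inl hpos.ne')
  have hvv' : ∀ t ∈ Set.Ioo (min (-1 : ℝ) 1) (max (-1) 1),
      HasDerivAt (iteratedDerivWithin l g (Set.Icc (-1) 1))
        (iteratedDerivWithin (l + 1) g (Set.Icc (-1) 1) t) t := by
    rw [min_eq_left hle, max_eq_right hle]
    intro t ht
    rw [iteratedDerivWithin_succ]
    exact ((hg.differentiableOn_iteratedDerivWithin (by exact_mod_cast hl) huniq) t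
      (Set.Ioo_subset_Icc_self ht)).hasDerivWithinAt.hasDerivAt (Icc_mem_nhds ht.1 ht.2)
  have hu' : IntervalIntegrable (iteratedDeriv (m + 1) (fun s : ℝ => (1 - s ^ 2) ^ α))
      volume (-1) 1 := by
    have hint := (intervalIntegrable_one_sub_sq_rpow (γ := α - (m + 1 : ℕ))
      (by push_cast; linarith)).continuousOn_mul (g := fun t => q.eval t) q.continuous.continuousOn
    refine hint.congr_uIoo fun t ht => ?_
    rw [Set.uIoo_of_le hle] at ht
    exact (hq t ht).symm
  have hparts := intervalIntegral.integral_mul_deriv_eq_deriv_mul_of_hasDerivAt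
    hu hv huu' hvv' hu' hv'
  have hzero : (0 : ℝ) ^ (α - m) = 0 := Real.zero_rpow (by linarith)
  rw [intervalIntegral.integral_congr_Ioo_of_le hle
    (g := fun t => p.eval t * (1 - t ^ 2) ^ (α - m) *
      iteratedDerivWithin (l + 1) g (Set.Icc (-1) 1) t)
    fun t ht => by simp only [hp t ht], hparts]
  simp [hzero]

/-- Iterated integration by parts against derivatives of `(1 - s²)^α`. -/
lemma integral_iteratedDeriv_mul_iteratedDerivWithin {α : ℝ} {k N : ℕ} (hα : (k + N : ℝ) < α + 1)
    {g : ℝ → ℝ} (hg : ContDiffOn ℝ N g (Set.Icc (-1) 1)) {i : ℕ} (hi : i ≤ N) :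
    ∫ t in (-1 : ℝ)..1, iteratedDeriv k (fun s : ℝ => (1 - s ^ 2) ^ α) t *
        iteratedDerivWithin i g (Set.Icc (-1) 1) t =
      (-1) ^ i * ∫ t in (-1 : ℝ)..1,
        iteratedDeriv (k + i) (fun s : ℝ => (1 - s ^ 2) ^ α) t * g t := by
  induction i generalizing k N with
  | zero => simp
  | succ i ih =>
    have hi' : (i : ℝ) + 1 ≤ N := by exact_mod_cast hi
    rw [integral_iteratedDeriv_mul_succ (by linarith) hi hg,
      ih (k := k + 1) (N := i) (by push_cast; linarith)
        (hg.of_le (by exact_mod_cast (Nat.le_of_succ_le hi))) le_rfl,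
      show k + 1 + i = k + (i + 1) by ring]
    ring

/-- The constant in the Rodrigues formula for `legendreP`. -/
def rodriguesConst (d k : ℕ) : ℝ :=
  (-1 : ℝ) ^ k *
    (Real.Gamma (((d : ℝ) - 1) / 2) / (2 ^ k * Real.Gamma (((d : ℝ) - 1) / 2 + k)))

/-- The multipliers in terms of derivatives of powers of `1 - s²`. -/
lemma multInt_eq_integral_iteratedDeriv (d k : ℕ) (h : ℝ → ℝ) :
    multInt d k h = omegaS (d - 1) * rodriguesConst d k *
      ∫ t in (-1 : ℝ)..1,
        iteratedDeriv k (fun s : ℝ => (1 - s ^ 2) ^ (((d : ℝ) - 3) / 2 + (k : ℝ))) t * h t := by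
  rw [multInt, mul_assoc, ← intervalIntegral.integral_const_mul (rodriguesConst d k)]
  congr 1
  refine intervalIntegral.integral_congr_Ioo_of_le (by norm_num) fun t ht => ?_
  have hpos : 0 < 1 - t ^ 2 := by nlinarith [ht.1, ht.2]
  have hcancel : (1 - t ^ 2) ^ (-(((d : ℝ) - 3) / 2)) * (1 - t ^ 2) ^ (((d : ℝ) - 3) / 2) = 1 := by
    rw [← Real.rpow_add hpos, neg_add_cancel, Real.rpow_zero]
  simp only [legendreP, rodriguesConst]
  linear_combination ((-1 : ℝ) ^ k *
    (Real.Gamma (((d : ℝ) - 1) / 2) / (2 ^ k * Real.Gamma (((d : ℝ) - 1) / 2 + k))) *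
    iteratedDeriv k (fun s : ℝ => (1 - s ^ 2) ^ (((d : ℝ) - 3) / 2 + (k : ℝ))) t * h t) * hcancel

/-- The surface area of the unit ball is `ω_m = 2 π^{m/2} / Γ(m/2)`. -/
lemma omegaS_mul_Gamma {m : ℕ} (hm : 0 < m) :
    omegaS m * Real.Gamma ((m : ℝ) / 2) = 2 * √Real.pi ^ m := by
  have hne : Nonempty (Fin m) := ⟨⟨0, hm⟩⟩
  have hm' : (0 : ℝ) < m := by exact_mod_cast hm
  have hΓ : 0 < Real.Gamma ((m : ℝ) / 2) := Real.Gamma_pos_of_pos (by positivity)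
  have hΓ1 : 0 < Real.Gamma ((m : ℝ) / 2 + 1) := Real.Gamma_pos_of_pos (by positivity)
  rw [omegaS, kappa, EuclideanSpace.volume_closedBall, ENNReal.toReal_mul,
    ENNReal.toReal_ofReal (by rw [Fintype.card_fin]; positivity)]
  rw [Fintype.card_fin, Real.Gamma_add_one (by positivity)]
  simp
  field_simp

lemma omegaS_mul_rodriguesConst {d : ℕ} (hd : 2 ≤ d) (k : ℕ) :
    omegaS (d - 1) * rodriguesConst d k =
      (-1) ^ k * (2 * √Real.pi ^ (d - 1)) / (2 ^ k * Real.Gamma (((d : ℝ) - 1) / 2 + k)) := by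
  have h := omegaS_mul_Gamma (m := d - 1) (by omega)
  rw [Nat.cast_sub (by omega), Nat.cast_one] at h
  rw [← h, rodriguesConst]
  ring

/-- **Lemma 3.5.** Multipliers of derivatives of zonal functions:
`a_k^n[ḡ^{(j)}] = (2π)^j a_{k+j}^{n-2j}[ḡ]` when `n ≥ 2(j+1)`. -/
theorem multipliers_of_derivatives
    (n j : ℕ) (hj : 0 < j) (hn : 2 * (j + 1) ≤ n)
    (g : ℝ → ℝ) (hg : ContDiffOn ℝ j g (Set.Icc (-1) 1)) :
    ∀ k : ℕ, multInt n k (iteratedDerivWithin j g (Set.Icc (-1) 1)) =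
      (2 * Real.pi) ^ j * multInt (n - 2 * j) (k + j) g := by
  intro k
  obtain ⟨d, rfl⟩ : ∃ d, n = d + 2 * j := ⟨n - 2 * j, by omega⟩
  have hd : 2 ≤ d := by omega
  have hd' : (2 : ℝ) ≤ d := by exact_mod_cast hd
  rw [Nat.add_sub_cancel, multInt_eq_integral_iteratedDeriv, multInt_eq_integral_iteratedDeriv,
    omegaS_mul_rodriguesConst (by omega), omegaS_mul_rodriguesConst hd]
  have hexp : (((d + 2 * j : ℕ) : ℝ) - 3) / 2 + (k : ℝ) =
      ((d : ℝ) - 3) / 2 + ((k + j : ℕ) : ℝ) := by push_cast; ring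
  have hΓ : (((d + 2 * j : ℕ) : ℝ) - 1) / 2 + (k : ℝ) =
      ((d : ℝ) - 1) / 2 + ((k + j : ℕ) : ℝ) := by push_cast; ring
  have hπ : √Real.pi ^ (d + 2 * j - 1) = √Real.pi ^ (d - 1) * Real.pi ^ j := by
    rw [show d + 2 * j - 1 = d - 1 + 2 * j by omega, pow_add, pow_mul,
      Real.sq_sqrt Real.pi_pos.le]
  rw [hexp, hΓ, hπ, integral_iteratedDeriv_mul_iteratedDerivWithin (N := j)
    (by push_cast; linarith) hg le_rfl, mul_pow, pow_add (2 : ℝ), pow_add (-1 : ℝ)]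
  have hΓpos : 0 < Real.Gamma (((d : ℝ) - 1) / 2 + ((k + j : ℕ) : ℝ)) :=
    Real.Gamma_pos_of_pos (by have : (0 : ℝ) ≤ ((k + j : ℕ) : ℝ) := by positivity
                              linarith)
  field_simp

end MinkIter
end
end

section
/- Let n ≥ 3, α ≥ 0, and g ∈ C²([−1,1]). Suppose there exist β > 0 and a constant C > 0 such that ‖∇²_{jl} T_g f‖_{𝒰_{α+β}} ≤ C‖f‖_{𝒰_α} for all f ∈ 𝒰_α and all j,l ∈ {1,…,n}. Then for all f₁,…,f_{n−1} ∈ 𝒰_α, the function D(D²T_g f₁,…,D²T_g f_{n−1}) belongs to 𝒰_{α+β}, and there exists a constant C' > 0 (depending only on g, α, β, n) such that ‖D(D²T_g f₁,…,D²T_g f_{n−1})‖_{𝒰_{α+β}} ≤ C' ‖f₁‖_{𝒰_α}⋯‖f_{n−1}‖_{𝒰_α}. -/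
open scoped InnerProductSpace Pointwise
open MeasureTheory Metric Filter Topology

noncomputable section

namespace MinkIter

variable {n : ℕ}

section Kernel

variable {X : Type*} [TopologicalSpace X]

/-- The kernel `∑ eᵢ(u) eᵢ(v)`. -/
def sumKernel {ι : Type*} [Fintype ι] (e : ι → C(X, ℝ)) (u v : X) : ℝ := ∑ i, e i u * e i v

variable {ι : Type*} [Fintype ι] {e : ι → C(X, ℝ)}

lemma sumKernel_comm (u v : X) : sumKernel e u v = sumKernel e v u :=
  Finset.sum_congr rfl fun _ _ => mul_comm _ _

lemma continuous_sumKernel : Continuous fun q : X × X => sumKernel e q.1 q.2 := by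
  unfold sumKernel
  fun_prop

/-- `sumKernel e u` as a bundled continuous function. -/
def sumKernelMap (e : ι → C(X, ℝ)) (u : X) : C(X, ℝ) := ∑ i, e i u • e i

lemma sumKernelMap_apply (u v : X) : sumKernelMap e u v = sumKernel e u v := by
  simp [sumKernelMap, sumKernel, ContinuousMap.sum_apply]

lemma sumKernel_self_nonneg (u : X) : 0 ≤ sumKernel e u u :=
  Finset.sum_nonneg fun _ _ => mul_self_nonneg _

lemma sumKernelMap_mem {W : Submodule ℝ C(X, ℝ)} (h : ∀ i, e i ∈ W) (u : X) :
    sumKernelMap e u ∈ W :=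
  Submodule.sum_mem _ fun i _ => W.smul_mem _ (h i)

variable {κ : Type*} [Fintype κ]

/-- The kernel of de la Vallée-Poussin type built from two families of functions. -/
def vpKernel (c : ℝ) (e : ι → C(X, ℝ)) (e' : κ → C(X, ℝ)) : C(X × X, ℝ) :=
  ⟨fun q => c⁻¹ * (sumKernel e q.1 q.2 * sumKernel e' q.1 q.2),
    continuous_const.mul (continuous_sumKernel.mul continuous_sumKernel)⟩

lemma vpKernel_symm (c : ℝ) (e : ι → C(X, ℝ)) (e' : κ → C(X, ℝ)) (u v : X) :
    vpKernel c e e' (u, v) = vpKernel c e e' (v, u) := by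
  simp only [vpKernel, ContinuousMap.coe_mk, sumKernel_comm u v]

end Kernel

section Reproducing

variable {X : Type*} [TopologicalSpace X] [CompactSpace X] [MeasurableSpace X] [BorelSpace X]

lemma _root_.ContinuousMap.integrable_of_finite (μ : Measure X) [IsFiniteMeasure μ] (f : C(X, ℝ)) :
    Integrable f μ :=
  f.continuous.integrable_of_hasCompactSupport (HasCompactSupport.of_compactSpace _)

/-- `e` is an orthonormal basis of `W ⊆ L²(μ)`, expressed through integrals of continuous
functions. -/
structure IsIntegralONB (μ : Measure X) (W : Submodule ℝ C(X, ℝ)) {ι : Type*} [Fintype ι]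
    (e : ι → C(X, ℝ)) : Prop where
  mem : ∀ i, e i ∈ W
  integral_sq : ∀ i, ∫ v, e i v * e i v ∂μ = 1
  expand : ∀ p ∈ W, ∀ u, p u = ∑ i, (∫ v, e i v * p v ∂μ) * e i u

/-- Every finite-dimensional space of continuous functions has an orthonormal basis. -/
lemma exists_isIntegralONB (μ : Measure X) [IsFiniteMeasure μ] [μ.IsOpenPosMeasure]
    (W : Submodule ℝ C(X, ℝ)) [FiniteDimensional ℝ W] :
    ∃ e : Fin (Module.finrank ℝ W) → C(X, ℝ), IsIntegralONB μ W e := by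
  set L : C(X, ℝ) →ₗ[ℝ] Lp ℝ 2 μ := (ContinuousMap.toLp (E := ℝ) 2 μ ℝ).toLinearMap with hL
  have hinj : Function.Injective L := ContinuousMap.toLp_injective μ
  have hinner (p q : C(X, ℝ)) : ⟪L p, L q⟫_ℝ = ∫ v, p v * q v ∂μ := by
    rw [MeasureTheory.L2.inner_def]
    apply integral_congr_ae
    filter_upwards [ContinuousMap.coeFn_toLp (p := 2) (𝕜 := ℝ) μ p,
      ContinuousMap.coeFn_toLp (p := 2) (𝕜 := ℝ) μ q] with v hp hq
    simp only [hL, ContinuousLinearMap.coe_coe, hp, hq]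
    simp [mul_comm]
  have hrank : Module.finrank ℝ (W.map L) = Module.finrank ℝ W :=
    (Submodule.equivMapOfInjective L hinj W).symm.finrank_eq
  let b := (stdOrthonormalBasis ℝ (W.map L)).reindex (finCongr hrank)
  have hb (i) : ∃ p ∈ W, L p = (b i : Lp ℝ 2 μ) := (b i).2
  choose e heW he using hb
  refine ⟨e, heW, fun i => ?_, fun p hp u => ?_⟩
  · rw [← hinner, he, ← Submodule.coe_inner, real_inner_self_eq_norm_sq, b.norm_eq_one]
    norm_num
  · have h1 := congrArg (Subtype.val) (b.sum_repr ⟨L p, Submodule.mem_map_of_mem hp⟩)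
    have h2 : L (∑ i, (∫ v, e i v * p v ∂μ) • e i) = L p := by
      rw [map_sum]
      refine Eq.trans ?_ h1
      rw [Submodule.coe_sum]
      refine Finset.sum_congr rfl fun i _ => ?_
      rw [map_smul, he, ← hinner, he, OrthonormalBasis.repr_apply_apply, Submodule.coe_inner]
      rfl
    have h3 := congrArg (fun q : C(X, ℝ) => q u) (hinj h2)
    simpa [ContinuousMap.sum_apply] using h3.symm

variable {ι : Type*} [Fintype ι] {e : ι → C(X, ℝ)} {W : Submodule ℝ C(X, ℝ)} {μ : Measure X}

lemma IsIntegralONB.integral_sumKernel_mul [IsFiniteMeasure μ] (h : IsIntegralONB μ W e)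
    {p : C(X, ℝ)} (hp : p ∈ W) (u : X) : ∫ v, sumKernel e u v * p v ∂μ = p u := by
  rw [h.expand p hp u]
  simp only [sumKernel, Finset.sum_mul]
  rw [integral_finsetSum]
  · refine Finset.sum_congr rfl fun i _ => ?_
    simp_rw [mul_assoc]
    rw [integral_const_mul, mul_comm]
  · intro i _
    exact (e i u • e i * p).integrable_of_finite μ

lemma IsIntegralONB.integral_sumKernel_sq [IsFiniteMeasure μ] (h : IsIntegralONB μ W e) (u : X) :
    ∫ v, sumKernel e u v ^ 2 ∂μ = sumKernel e u u := by
  have := h.integral_sumKernel_mul (sumKernelMap_mem h.mem u) u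
  simpa only [sumKernelMap_apply, ← sq] using this

lemma IsIntegralONB.integral_sumKernel_self [IsFiniteMeasure μ] (h : IsIntegralONB μ W e) :
    ∫ v, sumKernel e v v ∂μ = Fintype.card ι := by
  simp only [sumKernel]
  rw [integral_finsetSum]
  · simp [h.integral_sq]
  · exact fun i _ => (e i * e i).integrable_of_finite μ

/-- The Cauchy–Schwarz inequality for integrals. -/
lemma sq_integral_mul_le {Y : Type*} [MeasurableSpace Y] {ν : Measure Y} {f g : Y → ℝ}
    (hf : Integrable (fun y => f y ^ 2) ν) (hg : Integrable (fun y => g y ^ 2) ν)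
    (hfg : Integrable (fun y => f y * g y) ν) :
    (∫ y, f y * g y ∂ν) ^ 2 ≤ (∫ y, f y ^ 2 ∂ν) * ∫ y, g y ^ 2 ∂ν := by
  have key (t : ℝ) : 0 ≤ (∫ y, g y ^ 2 ∂ν) * (t * t) + (2 * ∫ y, f y * g y ∂ν) * t +
      ∫ y, f y ^ 2 ∂ν := by
    have h : ∫ y, (f y + t * g y) ^ 2 ∂ν = (∫ y, g y ^ 2 ∂ν) * (t * t) +
        (2 * ∫ y, f y * g y ∂ν) * t + ∫ y, f y ^ 2 ∂ν := by
      rw [← integral_mul_const, ← integral_const_mul, ← integral_mul_const, ← integral_add,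
        ← integral_add]
      · congr 1; ext y; ring
      · exact (hg.mul_const _).add ((hfg.const_mul _).mul_const _)
      · exact hf
      · exact hg.mul_const _
      · exact (hfg.const_mul _).mul_const _
    rw [← h]
    exact integral_nonneg fun y => sq_nonneg _
  have := discrim_le_zero key
  rw [discrim] at this
  nlinarith

/-- If `W` is invariant under a measure preserving map, then so is the diagonal of its
reproducing kernel. -/
lemma IsIntegralONB.sumKernel_self_le_of_invariant [IsFiniteMeasure μ] (h : IsIntegralONB μ W e)
    (R : C(X, X)) (hR : MeasurePreserving R μ μ) (hW : ∀ p ∈ W, p.comp R ∈ W) (u : X) :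
    sumKernel e (R u) (R u) ≤ sumKernel e u u := by
  set q : C(X, ℝ) := (sumKernelMap e (R u)).comp R with hq
  have hqv (v : X) : q v = sumKernel e (R u) (R v) := by simp [hq, sumKernelMap_apply]
  have h1 : ∫ v, q v ^ 2 ∂μ = sumKernel e (R u) (R u) := by
    rw [← h.integral_sumKernel_sq (R u)]
    simp only [hqv]
    rw [← integral_map (f := fun v => sumKernel e (R u) v ^ 2) R.continuous.aemeasurable,
      hR.map_eq]
    exact (((sumKernelMap e (R u)) ^ 2).integrable_of_finite _).aestronglyMeasurable.congr
      (by filter_upwards with v; simp [sumKernelMap_apply])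
  have h2 := h.integral_sumKernel_mul (hW _ (sumKernelMap_mem h.mem (R u))) u
  rw [← hq, hqv] at h2
  have h3 := sq_integral_mul_le (ν := μ) (f := sumKernel e u) (g := q)
    (((sumKernelMap e u ^ 2).integrable_of_finite μ).congr
      (by filter_upwards with v; simp [sumKernelMap_apply]))
    ((q ^ 2).integrable_of_finite μ)
    (((sumKernelMap e u * q).integrable_of_finite μ).congr
      (by filter_upwards with v; simp [sumKernelMap_apply]))
  rw [h2, h1, h.integral_sumKernel_sq] at h3
  rcases (sumKernel_self_nonneg (e := e) (R u)).eq_or_lt with h0 | h0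
  · rw [← h0]; exact sumKernel_self_nonneg u
  · exact le_of_mul_le_mul_right (by rwa [← sq]) h0

end Reproducing

section Averaging

variable {X : Type*} [TopologicalSpace X] [CompactSpace X] [MeasurableSpace X] [BorelSpace X]
  {μ : Measure X} [IsFiniteMeasure μ]

lemma integrable_kernel_mul (k : C(X, ℝ)) {h : X → ℝ} (hm : AEStronglyMeasurable h μ) {M : ℝ}
    (hM : ∀ v, |h v| ≤ M) : Integrable (fun v => k v * h v) μ := by
  refine Integrable.of_bound (k.continuous.aestronglyMeasurable.mul hm) (‖k‖ * M)
    (Eventually.of_forall fun v => ?_)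
  rw [norm_mul]
  exact mul_le_mul (k.norm_coe_le_norm v) (hM v) (norm_nonneg _) (norm_nonneg _)

/-- An integral operator whose kernel is bounded in `L¹` is bounded on bounded functions. -/
lemma abs_integral_kernel_mul_le (k : C(X, ℝ)) {D M : ℝ} (hD : ∫ v, |k v| ∂μ ≤ D)
    {h : X → ℝ} (hM0 : 0 ≤ M) (hM : ∀ v, |h v| ≤ M) :
    |∫ v, k v * h v ∂μ| ≤ D * M := by
  calc |∫ v, k v * h v ∂μ| ≤ ∫ v, |k v| * M ∂μ := by
        rw [← Real.norm_eq_abs]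
        refine norm_integral_le_of_norm_le (Integrable.mul_const (k.integrable_of_finite μ).abs M)
          (Eventually.of_forall fun v => ?_)
        rw [Real.norm_eq_abs, abs_mul]
        exact mul_le_mul_of_nonneg_left (hM v) (abs_nonneg _)
    _ = (∫ v, |k v| ∂μ) * M := integral_mul_const _ _
    _ ≤ D * M := mul_le_mul_of_nonneg_right hD hM0

/-- **Schur test** for a symmetric continuous kernel. -/
lemma schur_test [SecondCountableTopology X] (K : C(X × X, ℝ)) (hK : ∀ u v, K (u, v) = K (v, u)) {D : ℝ} (hD0 : 0 ≤ D)
    (hD : ∀ u, ∫ v, |K (u, v)| ∂μ ≤ D) {h : X → ℝ} (hm : AEStronglyMeasurable h μ) {M : ℝ}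
    (hM : ∀ v, |h v| ≤ M) :
    ∫ u, (∫ v, K (u, v) * h v ∂μ) ^ 2 ∂μ ≤ D ^ 2 * ∫ v, h v ^ 2 ∂μ := by
  let k (u : X) : C(X, ℝ) := ⟨fun v => |K (u, v)|, by fun_prop⟩
  have hm2 : AEStronglyMeasurable (fun v => h v ^ 2) μ := hm.pow 2
  have hM2 (v : X) : |h v ^ 2| ≤ M ^ 2 := by
    rw [abs_pow]; exact pow_le_pow_left₀ (abs_nonneg _) (hM v) 2
  have hint2 : Integrable (fun v => h v ^ 2) μ :=
    Integrable.of_bound hm2 _ (Eventually.of_forall hM2)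
  have hprod : Integrable (Function.uncurry fun u v => |K (u, v)| * h v ^ 2) (μ.prod μ) := by
    refine Integrable.of_bound (AEStronglyMeasurable.mul ?_ (hm2.comp_snd)) (‖K‖ * M ^ 2)
      (Eventually.of_forall fun q => ?_)
    · exact (by fun_prop : Continuous fun q : X × X => |K q|).aestronglyMeasurable
    · change ‖|K q| * h q.2 ^ 2‖ ≤ _
      rw [norm_mul, Real.norm_eq_abs, abs_abs]
      exact mul_le_mul (K.norm_coe_le_norm q) (hM2 _) (norm_nonneg _) (norm_nonneg _)
  have hpt (u : X) : (∫ v, K (u, v) * h v ∂μ) ^ 2 ≤ D * ∫ v, |K (u, v)| * h v ^ 2 ∂μ := by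
    have h1 : |∫ v, K (u, v) * h v ∂μ| ≤
        ∫ v, Real.sqrt |K (u, v)| * (Real.sqrt |K (u, v)| * |h v|) ∂μ := by
      refine (abs_integral_le_integral_abs).trans (le_of_eq (integral_congr_ae
        (Eventually.of_forall fun v => ?_)))
      simp only
      rw [abs_mul, ← mul_assoc, Real.mul_self_sqrt (abs_nonneg _)]
    have e1 : (fun v => Real.sqrt |K (u, v)| ^ 2) = fun v => |K (u, v)| := by
      ext v; exact Real.sq_sqrt (abs_nonneg _)
    have e2 : (fun v => (Real.sqrt |K (u, v)| * |h v|) ^ 2) = fun v => |K (u, v)| * h v ^ 2 := by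
      ext v; rw [mul_pow, Real.sq_sqrt (abs_nonneg _), sq_abs]
    have h2 := sq_integral_mul_le (ν := μ) (f := fun v => Real.sqrt |K (u, v)|)
      (g := fun v => Real.sqrt |K (u, v)| * |h v|)
      (by rw [e1]; exact (k u).integrable_of_finite μ)
      (by rw [e2]; exact integrable_kernel_mul (k u) hm2 hM2)
      (by
        refine (integrable_kernel_mul (k u) (h := fun v => |h v|) hm.norm (M := M)
          (by simpa using hM)).congr (Eventually.of_forall fun v => ?_)
        simp only [k, ContinuousMap.coe_mk]
        rw [← mul_assoc, Real.mul_self_sqrt (abs_nonneg _)])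
    rw [e1, e2] at h2
    calc (∫ v, K (u, v) * h v ∂μ) ^ 2 ≤ _ := by
          rw [← sq_abs]; exact pow_le_pow_left₀ (abs_nonneg _) h1 2
      _ ≤ _ := h2
      _ ≤ _ := mul_le_mul_of_nonneg_right (hD u) (integral_nonneg fun v => by positivity)
  calc ∫ u, (∫ v, K (u, v) * h v ∂μ) ^ 2 ∂μ
      ≤ ∫ u, D * ∫ v, |K (u, v)| * h v ^ 2 ∂μ ∂μ :=
        integral_mono_of_nonneg (Eventually.of_forall fun u => sq_nonneg _)
          (hprod.integral_prod_left.const_mul D) (Eventually.of_forall hpt)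
    _ = D * ∫ v, ∫ u, |K (u, v)| * h v ^ 2 ∂μ ∂μ := by
        rw [integral_const_mul, integral_integral_swap hprod]
    _ ≤ D * ∫ v, D * h v ^ 2 ∂μ := by
        refine mul_le_mul_of_nonneg_left ?_ hD0
        refine integral_mono_of_nonneg
          (Eventually.of_forall fun v => integral_nonneg fun u => by positivity)
          (hint2.const_mul D) (Eventually.of_forall fun v => ?_)
        simp only
        rw [integral_mul_const]
        refine mul_le_mul_of_nonneg_right ?_ (sq_nonneg _)
        simpa only [hK _ v] using hD v
    _ = D ^ 2 * ∫ v, h v ^ 2 ∂μ := by rw [integral_const_mul]; ring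

variable {ι κ : Type*} [Fintype ι] [Fintype κ]
variable {e : ι → C(X, ℝ)} {e' : κ → C(X, ℝ)} {W W' : Submodule ℝ C(X, ℝ)}

lemma integral_abs_vpKernel_le (he : IsIntegralONB μ W e) (he' : IsIntegralONB μ W' e')
    {c D : ℝ} (hc : 0 < c) (hD0 : 0 ≤ D) (u : X) (hc' : sumKernel e' u u = c)
    (hD : sumKernel e u u ≤ D ^ 2 * c) : ∫ v, |vpKernel c e e' (u, v)| ∂μ ≤ D := by
  let f : C(X, ℝ) := ⟨fun v => |sumKernelMap e u v|, by fun_prop⟩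
  let f' : C(X, ℝ) := ⟨fun v => |sumKernelMap e' u v|, by fun_prop⟩
  have h1 := sq_integral_mul_le ((f ^ 2).integrable_of_finite μ) ((f' ^ 2).integrable_of_finite μ)
    ((f * f').integrable_of_finite μ)
  have h2 : ∫ v, |vpKernel c e e' (u, v)| ∂μ = c⁻¹ * ∫ v, f v * f' v ∂μ := by
    rw [← integral_const_mul]
    refine integral_congr_ae (Eventually.of_forall fun v => ?_)
    simp [vpKernel, f, f', sumKernelMap_apply, abs_mul, abs_of_pos hc]
  simp only [f, f', ContinuousMap.coe_mk, sq_abs, sumKernelMap_apply, he.integral_sumKernel_sq,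
    he'.integral_sumKernel_sq, hc'] at h1 h2
  rw [h2, inv_mul_le_iff₀ hc]
  refine abs_le_of_sq_le_sq' (h1.trans ?_) (by positivity) |>.2
  nlinarith

/-- The operator with kernel `vpKernel` reproduces functions `p` with `p W' ⊆ W`. -/
lemma integral_vpKernel_mul (he : IsIntegralONB μ W e) (he' : IsIntegralONB μ W' e') {c : ℝ}
    (hc : c ≠ 0) (u : X) (hc' : sumKernel e' u u = c) {p : C(X, ℝ)}
    (hp : ∀ q ∈ W', q * p ∈ W) : ∫ v, vpKernel c e e' (u, v) * p v ∂μ = p u := by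
  have h := he.integral_sumKernel_mul (hp _ (sumKernelMap_mem he'.mem u)) u
  simp only [ContinuousMap.mul_apply, sumKernelMap_apply, hc'] at h
  simp only [vpKernel, ContinuousMap.coe_mk, mul_assoc]
  rw [integral_const_mul, h, inv_mul_cancel_left₀ hc]

/-- The operator with kernel `vpKernel` takes values in the span of the products of
`e` with the second family. -/
lemma integral_vpKernel_mul_eq_sum (c : ℝ) {h : X → ℝ} (hm : AEStronglyMeasurable h μ) {M : ℝ}
    (hM : ∀ v, |h v| ≤ M) (u : X) :
    ∫ v, vpKernel c e e' (u, v) * h v ∂μ =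
      (∑ i, ∑ j, (c⁻¹ * ∫ v, (e i * e' j) v * h v ∂μ) • (e i * e' j)) u := by
  have h1 (v : X) : vpKernel c e e' (u, v) * h v =
      ∑ i, ∑ j, (c⁻¹ * (e i * e' j) u) * ((e i * e' j) v * h v) := by
    simp only [vpKernel, ContinuousMap.coe_mk, sumKernel, ContinuousMap.mul_apply]
    rw [Finset.sum_mul_sum, Finset.mul_sum, Finset.sum_mul]
    refine Finset.sum_congr rfl fun i _ => ?_
    rw [Finset.mul_sum, Finset.sum_mul]
    exact Finset.sum_congr rfl fun j _ => by ring
  have h2 (i j) : Integrable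
      (fun v => (c⁻¹ * (e i * e' j) u) * ((e i * e' j) v * h v)) μ :=
    (integrable_kernel_mul (e i * e' j) hm hM).const_mul _
  simp only [h1]
  rw [integral_finsetSum _ fun i _ => integrable_finsetSum _ fun j _ => h2 i j]
  simp only [ContinuousMap.sum_apply, ContinuousMap.smul_apply, smul_eq_mul]
  refine Finset.sum_congr rfl fun i _ => ?_
  rw [integral_finsetSum _ fun j _ => h2 i j]
  refine Finset.sum_congr rfl fun j _ => ?_
  rw [integral_const_mul]
  ring

end Averaging

section SphericalPolynomials

/-- Restriction of polynomials to the unit sphere. -/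
def polyRestr (n : ℕ) : MvPolynomial (Fin n) ℝ →ₐ[ℝ] C(Sph n, ℝ) :=
  MvPolynomial.aeval fun j => ⟨fun u => (u : En n) j, by fun_prop⟩

lemma polyRestr_apply (p : MvPolynomial (Fin n) ℝ) (u : Sph n) :
    polyRestr n p u = MvPolynomial.eval (fun j => (u : En n) j) p := by
  simp [polyRestr, MvPolynomial.aeval_def, MvPolynomial.eval₂_eq, MvPolynomial.eval_eq,
    ContinuousMap.sum_apply]

/-- The restrictions to the sphere of the polynomials of degree at most `k`. -/
def polySpace (n k : ℕ) : Submodule ℝ C(Sph n, ℝ) :=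
  (MvPolynomial.restrictTotalDegree (Fin n) ℝ k).map (polyRestr n).toLinearMap

lemma mem_polySpace {k : ℕ} {f : C(Sph n, ℝ)} :
    f ∈ polySpace n k ↔ ∃ p : MvPolynomial (Fin n) ℝ, p.totalDegree ≤ k ∧ polyRestr n p = f := by
  simp [polySpace, MvPolynomial.mem_restrictTotalDegree]

instance (k : ℕ) : FiniteDimensional ℝ (polySpace n k) := by
  unfold polySpace
  infer_instance

lemma mul_mem_polySpace {k l : ℕ} {f g : C(Sph n, ℝ)} (hf : f ∈ polySpace n k)
    (hg : g ∈ polySpace n l) : f * g ∈ polySpace n (k + l) := by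
  obtain ⟨p, hp, rfl⟩ := mem_polySpace.1 hf
  obtain ⟨q, hq, rfl⟩ := mem_polySpace.1 hg
  exact mem_polySpace.2 ⟨p * q, (MvPolynomial.totalDegree_mul _ _).trans (add_le_add hp hq),
    map_mul _ _ _⟩

lemma one_mem_polySpace (k : ℕ) : (1 : C(Sph n, ℝ)) ∈ polySpace n k :=
  mem_polySpace.2 ⟨1, by simp, map_one _⟩

lemma totalDegree_bind₁_le {σ τ R : Type*} [CommSemiring R] (L : σ → MvPolynomial τ R)
    (hL : ∀ j, (L j).totalDegree ≤ 1) (p : MvPolynomial σ R) :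
    (MvPolynomial.bind₁ L p).totalDegree ≤ p.totalDegree := by
  rw [MvPolynomial.bind₁, MvPolynomial.aeval_def, MvPolynomial.eval₂_eq]
  refine MvPolynomial.totalDegree_finsetSum_le fun d hd => ?_
  refine (MvPolynomial.totalDegree_mul _ _).trans ?_
  rw [MvPolynomial.algebraMap_eq, MvPolynomial.totalDegree_C, zero_add]
  refine (MvPolynomial.totalDegree_finsetProd _ _).trans ?_
  refine le_trans (Finset.sum_le_sum fun i _ => ?_) (MvPolynomial.le_totalDegree hd)
  exact (MvPolynomial.totalDegree_pow _ _).trans (by simpa using Nat.mul_le_mul_left (d i) (hL i))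

/-- The action of a linear isometry on the sphere. -/
def sphMap (R : En n ≃ₗᵢ[ℝ] En n) : C(Sph n, Sph n) :=
  ⟨fun u => ⟨R u, by simp⟩, by fun_prop⟩

lemma exists_sphMap_eq (u v : Sph n) : ∃ R : En n ≃ₗᵢ[ℝ] En n, sphMap R u = v :=
  ⟨_, Subtype.ext (Submodule.reflection_sub (v := (u : En n)) (w := v) (by simp))⟩

lemma comp_sphMap_mem_polySpace (R : En n ≃ₗᵢ[ℝ] En n) {k : ℕ} {f : C(Sph n, ℝ)}
    (hf : f ∈ polySpace n k) : f.comp (sphMap R) ∈ polySpace n k := by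
  obtain ⟨p, hp, rfl⟩ := mem_polySpace.1 hf
  let L (j : Fin n) : MvPolynomial (Fin n) ℝ :=
    ∑ i, MvPolynomial.C (R (EuclideanSpace.single i 1) j) * MvPolynomial.X i
  have hL (j : Fin n) : (L j).totalDegree ≤ 1 :=
    MvPolynomial.totalDegree_finsetSum_le fun i _ =>
      (MvPolynomial.totalDegree_mul _ _).trans (by simp)
  refine mem_polySpace.2 ⟨MvPolynomial.bind₁ L p, (totalDegree_bind₁_le L hL p).trans hp, ?_⟩
  ext u
  rw [ContinuousMap.comp_apply, polyRestr_apply, polyRestr_apply]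
  change MvPolynomial.eval₂Hom (RingHom.id ℝ) _ (MvPolynomial.bind₁ L p) = _
  rw [MvPolynomial.eval₂Hom_bind₁]
  change MvPolynomial.eval _ p = _
  congr 2
  ext j
  have hu : (u : En n) = ∑ i, (u : En n) i • EuclideanSpace.single i (1 : ℝ) := by
    simpa using ((EuclideanSpace.basisFun (Fin n) ℝ).sum_repr (u : En n)).symm
  have : (sphMap R u : En n) = ∑ i, (u : En n) i • R (EuclideanSpace.single i (1 : ℝ)) := by
    change R u = _
    conv_lhs => rw [hu]
    simp
  rw [this]
  simp [L, mul_comm]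

instance : IsFiniteMeasure (sphVol n) := by unfold sphVol; infer_instance

instance : (sphVol n).IsOpenPosMeasure := by unfold sphVol; infer_instance

lemma measurePreserving_sphMap (R : En n ≃ₗᵢ[ℝ] En n) :
    MeasurePreserving (sphMap R) (sphVol n) (sphVol n) := by
  refine ⟨(sphMap R).continuous.measurable, ?_⟩
  ext s hs
  have hs' := (sphMap R).continuous.measurable hs
  rw [Measure.map_apply (sphMap R).continuous.measurable hs, sphVol, Measure.toSphere_apply' _ hs',
    Measure.toSphere_apply' _ hs]
  congr 1
  rw [← R.measurePreserving.measure_preimage_emb R.toHomeomorph.measurableEmbedding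
    (Set.Ioo (0 : ℝ) 1 • (Subtype.val '' s))]
  congr 1
  ext x
  simp only [Set.mem_smul, Set.mem_image, Set.mem_preimage]
  constructor
  · rintro ⟨r, hr, _, ⟨u, hu, rfl⟩, rfl⟩
    exact ⟨r, hr, _, ⟨_, hu, rfl⟩, by simp [sphMap]⟩
  · rintro ⟨r, hr, _, ⟨u, hu, rfl⟩, h⟩
    refine ⟨r, hr, _, ⟨sphMap R.symm u, ?_, rfl⟩, ?_⟩
    · convert hu
      exact Subtype.ext (by simp [sphMap])
    · apply R.injective
      rw [← h]
      simp [sphMap]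

lemma card_pow_le_finrank_polySpace {m : ℕ} (hm : 0 < m) (k : ℕ) :
    (k / m + 1) ^ m ≤ Module.finrank ℝ (polySpace (m + 1) k) := by
  let T : MvPolynomial (Fin m) ℝ →ₗ[ℝ] C(Sph (m + 1), ℝ) :=
    ((polyRestr (m + 1)).comp (MvPolynomial.rename Fin.succ)).toLinearMap
  have hT : LinearMap.ker T = ⊥ := by
    rw [LinearMap.ker_eq_bot']
    intro p hp
    refine MvPolynomial.funext_set (fun _ => Set.Icc (0 : ℝ) (1 / (m + 1)))
      (fun _ => Set.Icc_infinite (by positivity)) fun x hx => ?_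
    have hx' (i : Fin m) : x i ^ 2 ≤ 1 / (m + 1) := by
      have h := hx i (Set.mem_univ i)
      have h1 : (1 : ℝ) / (m + 1) ≤ 1 := by
        rw [div_le_one (by positivity)]; linarith [(Nat.cast_nonneg m : (0 : ℝ) ≤ m)]
      nlinarith [h.1, h.2]
    have hsum : ∑ i, x i ^ 2 ≤ 1 := by
      refine (Finset.sum_le_sum fun i _ => hx' i).trans ?_
      rw [Finset.sum_const, Finset.card_univ, Fintype.card_fin, nsmul_eq_mul, mul_one_div,
        div_le_one (by positivity)]
      linarith
    let u : Sph (m + 1) :=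
      ⟨WithLp.toLp 2 (Fin.cons (Real.sqrt (1 - ∑ i, x i ^ 2)) x : Fin (m + 1) → ℝ), by
        rw [mem_sphere_zero_iff_norm, EuclideanSpace.norm_eq, Fin.sum_univ_succ]
        simp [Real.sq_sqrt (sub_nonneg.2 hsum)]⟩
    have h := congrArg (fun f : C(Sph (m + 1), ℝ) => f u) hp
    simp only [T, AlgHom.toLinearMap_apply, AlgHom.comp_apply, polyRestr_apply,
      MvPolynomial.eval_rename, ContinuousMap.zero_apply] at h
    rw [map_zero, ← h]
    rfl
  let b (a : Fin m → Fin (k / m + 1)) : MvPolynomial (Fin m) ℝ :=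
    MvPolynomial.monomial (Finsupp.equivFunOnFinite.symm fun i => (a i : ℕ)) 1
  have hb : LinearIndependent ℝ b := by
    have := (MvPolynomial.basisMonomials (Fin m) ℝ).linearIndependent.comp
      (fun a : Fin m → Fin (k / m + 1) => Finsupp.equivFunOnFinite.symm fun i => (a i : ℕ))
      (fun a a' h => by
        ext i
        exact congrFun (Finsupp.equivFunOnFinite.symm.injective h) i)
    simpa [Function.comp_def] using this
  have hmem (a) : T (b a) ∈ polySpace (m + 1) k := by
    refine mem_polySpace.2 ⟨_, (MvPolynomial.totalDegree_rename_le _ _).trans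
      ((MvPolynomial.totalDegree_monomial_le _ _).trans ?_), rfl⟩
    rw [Finsupp.sum_fintype _ _ fun _ => rfl]
    simp only [Finsupp.coe_equivFunOnFinite_symm, id]
    refine (Finset.sum_le_sum fun i _ => Nat.lt_succ_iff.1 (a i).2).trans ?_
    simpa using Nat.mul_div_le k m
  have hli : LinearIndependent ℝ fun a => (⟨T (b a), hmem a⟩ : polySpace (m + 1) k) :=
    LinearIndependent.of_comp (polySpace (m + 1) k).subtype (hb.map' T hT)
  simpa using hli.fintype_card_le_finrank

lemma finrank_polySpace_le (m N : ℕ) :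
    Module.finrank ℝ (polySpace (m + 1) N) ≤ 2 * (N + 1) ^ m := by
  let x (j : Fin (m + 1)) : C(Sph (m + 1), ℝ) := ⟨fun u => (u : En (m + 1)) j, by fun_prop⟩
  let y (c : ℕ) (b : Fin m → ℕ) : C(Sph (m + 1), ℝ) := x 0 ^ c * ∏ i, x (Fin.succ i) ^ b i
  let F (q : Fin 2 × (Fin m → Fin (N + 1))) : C(Sph (m + 1), ℝ) := y q.1 fun i => q.2 i
  have hx0 : x 0 ^ 2 = 1 - ∑ i : Fin m, x (Fin.succ i) ^ 2 := by
    ext u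
    have h := EuclideanSpace.norm_sq_eq (u : En (m + 1))
    rw [norm_eq_of_mem_sphere u, Fin.sum_univ_succ] at h
    simp only [Real.norm_eq_abs, sq_abs] at h
    simp only [x, ContinuousMap.pow_apply, ContinuousMap.sub_apply, ContinuousMap.one_apply,
      ContinuousMap.sum_apply, ContinuousMap.coe_mk]
    linarith
  have hy (c : ℕ) : ∀ b : Fin m → ℕ, c + ∑ i, b i ≤ N → y c b ∈ Submodule.span ℝ (Set.range F) := by
    induction c using Nat.strong_induction_on with
    | _ c ih =>
      intro b hb
      by_cases hc : c < 2
      · refine Submodule.subset_span ⟨(⟨c, hc⟩, fun i => ⟨b i, ?_⟩), rfl⟩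
        have := Finset.single_le_sum (f := b) (fun i _ => Nat.zero_le _) (Finset.mem_univ i)
        omega
      · obtain ⟨c, rfl⟩ := Nat.exists_eq_add_of_le (not_lt.1 hc)
        have h1 : y (2 + c) b =
            y c b - ∑ i, y c (fun i' => b i' + if i' = i then 2 else 0) := by
          simp only [y, pow_add, hx0, Finset.prod_mul_distrib, pow_ite, pow_zero,
            Finset.prod_ite_eq', Finset.mem_univ, if_true]
          simp only [← mul_assoc, ← Finset.mul_sum]
          ring
        rw [h1]
        refine Submodule.sub_mem _ (ih c (by omega) b (by omega))
          (Submodule.sum_mem _ fun i _ => ih c (by omega) _ ?_)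
        simp only [Finset.sum_add_distrib, Finset.sum_ite_eq', Finset.mem_univ, if_true]
        omega
  have hle : polySpace (m + 1) N ≤ Submodule.span ℝ (Set.range F) := by
    intro f hf
    obtain ⟨p, hp, rfl⟩ := mem_polySpace.1 hf
    rw [polyRestr, MvPolynomial.aeval_def, MvPolynomial.eval₂_eq']
    refine Submodule.sum_mem _ fun d hd => ?_
    rw [← Algebra.smul_def, Fin.prod_univ_succ]
    refine Submodule.smul_mem _ _ (hy (d 0) (fun i => d i.succ) ?_)
    have := (MvPolynomial.le_totalDegree hd).trans hp
    rwa [Finsupp.sum_fintype _ _ fun _ => rfl, Fin.sum_univ_succ] at this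
  have : FiniteDimensional ℝ (Submodule.span ℝ (Set.range F)) :=
    FiniteDimensional.span_of_finite ℝ (Set.finite_range F)
  refine (Submodule.finrank_mono hle).trans ((finrank_range_le_card F).trans ?_)
  simp

/-- Doubling of the dimension of spaces of spherical polynomials. -/
lemma finrank_polySpace_two_mul_le {m : ℕ} (hm : 0 < m) (k : ℕ) :
    Module.finrank ℝ (polySpace (m + 1) (2 * k)) ≤
      2 * (2 * m) ^ m * Module.finrank ℝ (polySpace (m + 1) k) := by
  have h1 : 2 * k + 1 ≤ 2 * m * (k / m + 1) := by
    have := Nat.lt_mul_div_succ k hm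
    rw [mul_assoc]
    omega
  calc _ ≤ 2 * (2 * k + 1) ^ m := finrank_polySpace_le m (2 * k)
    _ ≤ 2 * (2 * m * (k / m + 1)) ^ m := by gcongr
    _ = 2 * (2 * m) ^ m * (k / m + 1) ^ m := by rw [mul_pow]; ring
    _ ≤ _ := Nat.mul_le_mul_left _ (card_pow_le_finrank_polySpace hm k)

end SphericalPolynomials

section Approximation

variable {ι : Type*} [Fintype ι] {e : ι → C(Sph n, ℝ)}

lemma sumKernel_self_eq {k : ℕ} (h : IsIntegralONB (sphVol n) (polySpace n k) e) (u v : Sph n) :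
    sumKernel e u u = sumKernel e v v := by
  have key (u v : Sph n) : sumKernel e v v ≤ sumKernel e u u := by
    obtain ⟨R, rfl⟩ := exists_sphMap_eq u v
    exact h.sumKernel_self_le_of_invariant (sphMap R) (measurePreserving_sphMap R)
      (fun p hp => comp_sphMap_mem_polySpace R hp) u
  exact le_antisymm (key v u) (key u v)

lemma sumKernel_self_mul_measure {k : ℕ} (h : IsIntegralONB (sphVol n) (polySpace n k) e)
    (u : Sph n) : sumKernel e u u * (sphVol n).real Set.univ = Fintype.card ι := by
  rw [← h.integral_sumKernel_self]
  simp_rw [fun v => sumKernel_self_eq h v u]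
  simp [mul_comm]

lemma sumKernel_self_pos {k : ℕ} (h : IsIntegralONB (sphVol n) (polySpace n k) e) (u : Sph n) :
    0 < sumKernel e u u := by
  refine (sumKernel_self_nonneg u).lt_of_ne fun h0 => ?_
  have h1 := (Finset.sum_eq_zero_iff_of_nonneg fun i _ => mul_self_nonneg _).1 h0.symm
  have h2 := h.expand 1 (one_mem_polySpace k) u
  rw [Finset.sum_eq_zero fun i hi => by rw [mul_self_eq_zero.1 (h1 i hi), mul_zero]] at h2
  simp at h2

/-- Boundedness and measurability of the restriction of `f` to the sphere. -/
structure IsBddMeas (f : En n → ℝ) : Prop where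
  meas : AEStronglyMeasurable (fun u : Sph n => f u) (sphVol n)
  bdd : ∃ M, ∀ u : Sph n, |f u| ≤ M

namespace IsBddMeas

variable {f g : En n → ℝ}

lemma integrable (hf : IsBddMeas f) : Integrable (fun u : Sph n => f u) (sphVol n) := by
  obtain ⟨M, hM⟩ := hf.bdd
  exact Integrable.of_bound hf.meas M (Eventually.of_forall hM)

lemma add (hf : IsBddMeas f) (hg : IsBddMeas g) : IsBddMeas fun x => f x + g x := by
  obtain ⟨M, hM⟩ := hf.bdd
  obtain ⟨N, hN⟩ := hg.bdd
  exact ⟨hf.meas.add hg.meas, M + N, fun u => (abs_add_le _ _).trans (add_le_add (hM u) (hN u))⟩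

lemma mul (hf : IsBddMeas f) (hg : IsBddMeas g) : IsBddMeas fun x => f x * g x := by
  obtain ⟨M, hM⟩ := hf.bdd
  obtain ⟨N, hN⟩ := hg.bdd
  refine ⟨hf.meas.mul hg.meas, M * N, fun u => ?_⟩
  rw [abs_mul]
  exact mul_le_mul (hM u) (hN u) (abs_nonneg _) ((abs_nonneg _).trans (hM u))

lemma const (c : ℝ) : IsBddMeas fun _ : En n => c :=
  ⟨aestronglyMeasurable_const, |c|, fun _ => le_rfl⟩

lemma of_continuous (F : C(Sph n, ℝ)) (hF : ∀ u : Sph n, f u = F u) : IsBddMeas f := by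
  refine ⟨?_, ‖F‖, fun u => ?_⟩
  · simp only [hF]
    exact F.continuous.aestronglyMeasurable
  · rw [hF]
    exact F.norm_coe_le_norm u

lemma eval (p : MvPolynomial (Fin n) ℝ) :
    IsBddMeas fun x : En n => MvPolynomial.eval (fun j => x j) p :=
  of_continuous (polyRestr n p) fun u => (polyRestr_apply p u).symm

lemma sub (hf : IsBddMeas f) (hg : IsBddMeas g) : IsBddMeas fun x => f x - g x := by
  simpa [sub_eq_add_neg] using hf.add ((const (-1)).mul hg)

lemma sq_integrable (hf : IsBddMeas f) :
    Integrable (fun u : Sph n => f u ^ 2) (sphVol n) := by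
  simpa [sq] using (hf.mul hf).integrable

end IsBddMeas

variable {f g : En n → ℝ}

lemma sphL2_congr (h : ∀ u : Sph n, f u = g u) : sphL2 f = sphL2 g := by
  simp only [sphL2, h]

lemma sphL2_sub_comm : sphL2 (fun x => f x - g x) = sphL2 fun x => g x - f x := by
  simp only [sphL2, sub_sq_comm]

lemma sphL2_add_le (hf : IsBddMeas f) (hg : IsBddMeas g) :
    sphL2 (fun x => f x + g x) ≤ sphL2 f + sphL2 g := by
  have h1 := sq_integral_mul_le hf.sq_integrable hg.sq_integrable (hf.mul hg).integrable
  have h2 := Real.abs_le_sqrt h1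
  rw [Real.sqrt_mul (integral_nonneg fun _ => sq_nonneg _)] at h2
  have h3 : ∫ u : Sph n, (f u + g u) ^ 2 ∂(sphVol n) = ∫ u : Sph n, f u ^ 2 ∂(sphVol n) +
      2 * ∫ u : Sph n, f u * g u ∂(sphVol n) + ∫ u : Sph n, g u ^ 2 ∂(sphVol n) := by
    rw [← integral_const_mul, ← integral_add hf.sq_integrable ((hf.mul hg).integrable.const_mul 2),
      ← integral_add _ hg.sq_integrable]
    · congr 1; ext u; ring
    · exact hf.sq_integrable.add ((hf.mul hg).integrable.const_mul 2)
  unfold sphL2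
  refine Real.sqrt_le_iff.2 ⟨by positivity, ?_⟩
  rw [h3, add_sq, Real.sq_sqrt (integral_nonneg fun _ => sq_nonneg _),
    Real.sq_sqrt (integral_nonneg fun _ => sq_nonneg _)]
  linarith [le_abs_self (∫ u : Sph n, f u * g u ∂(sphVol n))]

lemma sphL2_le_of_sq_le {c : ℝ} (hc : 0 ≤ c)
    (h : ∫ u : Sph n, f u ^ 2 ∂(sphVol n) ≤ c ^ 2 * ∫ u : Sph n, g u ^ 2 ∂(sphVol n)) :
    sphL2 f ≤ c * sphL2 g := by
  unfold sphL2
  calc _ ≤ Real.sqrt (c ^ 2 * ∫ u : Sph n, g u ^ 2 ∂(sphVol n)) := Real.sqrt_le_sqrt h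
    _ = _ := by rw [Real.sqrt_mul (sq_nonneg c), Real.sqrt_sq hc]

lemma sphL2_mul_le {M : ℝ} (hM0 : 0 ≤ M) (hM : ∀ u : Sph n, |f u| ≤ M) (hg : IsBddMeas g) :
    sphL2 (fun x => f x * g x) ≤ M * sphL2 g := by
  refine sphL2_le_of_sq_le hM0 ?_
  rw [← integral_const_mul]
  refine integral_mono_of_nonneg (Eventually.of_forall fun u => sq_nonneg _)
    (hg.sq_integrable.const_mul _) (Eventually.of_forall fun u => ?_)
  simp only [mul_pow]
  refine mul_le_mul_of_nonneg_right ?_ (sq_nonneg _)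
  rw [← sq_abs]
  exact pow_le_pow_left₀ (abs_nonneg _) (hM u) 2

lemma sphL2_one : sphL2 (fun _ : En n => 1) = Real.sqrt ((sphVol n).real Set.univ) := by
  simp [sphL2]

/-- Near-best polynomial approximation in `L²` by polynomials that are bounded in `L^∞`. -/
lemma exists_bounded_approx {m : ℕ} (hm : 0 < m) :
    ∃ D : ℝ, 0 ≤ D ∧ ∀ (k : ℕ) (f : En (m + 1) → ℝ) (M : ℝ),
      AEStronglyMeasurable (fun u : Sph (m + 1) => f u) (sphVol (m + 1)) → 0 ≤ M →
      (∀ u : Sph (m + 1), |f u| ≤ M) →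
      ∃ q : MvPolynomial (Fin (m + 1)) ℝ, q.totalDegree ≤ 3 * k ∧
        (∀ u : Sph (m + 1), |MvPolynomial.eval (fun j => (u : En (m + 1)) j) q| ≤ D * M) ∧
        ∀ p : MvPolynomial (Fin (m + 1)) ℝ, p.totalDegree ≤ k →
          sphL2 (fun x => f x - MvPolynomial.eval (fun j => x j) q) ≤
            (1 + D) * sphL2 fun x => f x - MvPolynomial.eval (fun j => x j) p := by
  refine ⟨Real.sqrt (2 * (2 * m) ^ m), Real.sqrt_nonneg _, fun k f M hf hM0 hM => ?_⟩
  set D := Real.sqrt (2 * (2 * m) ^ m) with hDdef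
  have hD0 : 0 ≤ D := Real.sqrt_nonneg _
  set μ := sphVol (m + 1)
  obtain ⟨e, he⟩ := exists_isIntegralONB μ (polySpace (m + 1) (2 * k))
  obtain ⟨e', he'⟩ := exists_isIntegralONB μ (polySpace (m + 1) k)
  let u₀ : Sph (m + 1) := ⟨EuclideanSpace.single 0 1, by simp⟩
  have : Nonempty (Sph (m + 1)) := ⟨u₀⟩
  set c := sumKernel e' u₀ u₀ with hc_def
  have hc : 0 < c := sumKernel_self_pos he' u₀
  have hc' (u) : sumKernel e' u u = c := sumKernel_self_eq he' u u₀
  have hω : 0 < μ.real Set.univ := measureReal_univ_pos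
  have hratio (u) : sumKernel e u u ≤ D ^ 2 * c := by
    have h1 := sumKernel_self_mul_measure he u
    have h2 := sumKernel_self_mul_measure he' u₀
    refine le_of_mul_le_mul_right ?_ hω
    rw [mul_assoc, hc_def, h1, h2, hDdef, Real.sq_sqrt (by positivity), Fintype.card_fin,
      Fintype.card_fin]
    exact_mod_cast finrank_polySpace_two_mul_le hm k
  let K := vpKernel c e e'
  have hKD (u) : ∫ v, |K (u, v)| ∂μ ≤ D :=
    integral_abs_vpKernel_le he he' hc hD0 u (hc' u) (hratio u)
  have hmem : (∑ i, ∑ j, (c⁻¹ * ∫ v, (e i * e' j) v * f v ∂μ) • (e i * e' j)) ∈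
      polySpace (m + 1) (3 * k) := by
    refine Submodule.sum_mem _ fun i _ => Submodule.sum_mem _ fun j _ => Submodule.smul_mem _ _ ?_
    have := mul_mem_polySpace (he.mem i) (he'.mem j)
    rwa [show 2 * k + k = 3 * k by ring] at this
  obtain ⟨q, hq, hqe⟩ := mem_polySpace.1 hmem
  have hqv (u : Sph (m + 1)) : MvPolynomial.eval (fun j => (u : En (m + 1)) j) q =
      ∫ v : Sph (m + 1), K (u, v) * f v ∂μ := by
    rw [← polyRestr_apply, hqe, integral_vpKernel_mul_eq_sum (h := fun v : Sph (m + 1) => f v)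
      c hf hM u]
  refine ⟨q, hq, fun u => ?_, fun p hp => ?_⟩
  · rw [hqv]
    exact abs_integral_kernel_mul_le (K.comp ⟨fun v => (u, v), by fun_prop⟩) (hKD u) hM0 hM
  · have hfb : IsBddMeas f := ⟨hf, M, hM⟩
    have hfp := hfb.sub (IsBddMeas.eval p)
    have hpf := (IsBddMeas.eval p).sub hfb
    have hqp := (IsBddMeas.eval p).sub (IsBddMeas.eval q)
    obtain ⟨N, hN⟩ := hpf.bdd
    have hp_repr (u : Sph (m + 1)) : ∫ v : Sph (m + 1), K (u, v) * polyRestr (m + 1) p v ∂μ =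
        polyRestr (m + 1) p u :=
      integral_vpKernel_mul he he' hc.ne' u (hc' u) fun r hr => by
        have := mul_mem_polySpace hr (mem_polySpace.2 ⟨p, hp, rfl⟩)
        rwa [← two_mul] at this
    have hdiff (u : Sph (m + 1)) : MvPolynomial.eval (fun j => (u : En (m + 1)) j) p -
        MvPolynomial.eval (fun j => (u : En (m + 1)) j) q =
        ∫ v : Sph (m + 1), K (u, v) *
          (MvPolynomial.eval (fun j => (v : En (m + 1)) j) p - f v) ∂μ := by
      rw [hqv, ← polyRestr_apply, ← hp_repr u, ← integral_sub]
      · simp only [polyRestr_apply, mul_sub]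
      · exact (K.comp ⟨fun v => (u, v), by fun_prop⟩ * polyRestr (m + 1) p).integrable_of_finite μ
      · exact integrable_kernel_mul (K.comp ⟨fun v => (u, v), by fun_prop⟩) hf hM
    have h1 : sphL2 (fun x => MvPolynomial.eval (fun j => x j) p -
        MvPolynomial.eval (fun j => x j) q) ≤
        D * sphL2 (fun x : En (m + 1) => MvPolynomial.eval (fun j => x j) p - f x) := by
      refine sphL2_le_of_sq_le hD0 ?_
      simp only [hdiff]
      exact schur_test K (vpKernel_symm c e e') hD0 hKD hpf.meas hN
    calc _ ≤ _ := (sphL2_congr fun u => by ring).trans_le (sphL2_add_le hfp hqp)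
      _ ≤ _ := add_le_add_right h1 _
      _ = _ := by rw [sphL2_sub_comm (g := f)]; ring

end Approximation

section ProductEstimate

/-- `M` witnesses `‖f‖_{𝒰_γ} ≤ M`, and `f` is measurable on the sphere. -/
structure IsUBound (γ M : ℝ) (f : En n → ℝ) : Prop where
  meas : AEStronglyMeasurable (fun u : Sph n => f u) (sphVol n)
  mem : M ∈ UBounds γ f

lemma rpow_neg_le_mul {γ : ℝ} (hγ : 0 ≤ γ) {c i k : ℕ} (hk : 0 < k) (hc : 0 < c)
    (h : k ≤ c * i) : (i : ℝ) ^ (-γ) ≤ (c : ℝ) ^ γ * (k : ℝ) ^ (-γ) := by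
  have hk' : (0 : ℝ) < k := by exact_mod_cast hk
  have hc' : (0 : ℝ) < c := by exact_mod_cast hc
  have h' : (k : ℝ) ≤ c * i := by exact_mod_cast h
  calc (i : ℝ) ^ (-γ) ≤ ((k : ℝ) / c) ^ (-γ) :=
        Real.rpow_le_rpow_of_nonpos (by positivity) ((div_le_iff₀' hc').2 h') (by linarith)
    _ = _ := by
        rw [Real.div_rpow hk'.le hc'.le, Real.rpow_neg hc'.le, div_inv_eq_mul, mul_comm]

lemma nonneg_of_mem_UBounds {m : ℕ} {γ M : ℝ} {f : En (m + 1) → ℝ} (h : M ∈ UBounds γ f) :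
    0 ≤ M :=
  (abs_nonneg _).trans (h.1 (EuclideanSpace.single 0 1) (by simp))

namespace IsUBound

variable {γ M N : ℝ} {f g : En n → ℝ}

lemma abs_le (h : IsUBound γ M f) (u : Sph n) : |f u| ≤ M :=
  h.mem.1 u (by simp)

lemma isBddMeas (h : IsUBound γ M f) : IsBddMeas f := ⟨h.meas, M, h.abs_le⟩

lemma mono (h : IsUBound γ M f) (hMN : M ≤ N) : IsUBound γ N f where
  meas := h.meas
  mem := by
    refine ⟨fun u hu => (h.mem.1 u hu).trans hMN, fun k hk => ?_⟩
    obtain ⟨p, hp, hpe⟩ := h.mem.2 k hk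
    exact ⟨p, hp, hpe.trans (by gcongr)⟩

lemma of_eval {p : MvPolynomial (Fin n) ℝ} (hp : p.totalDegree ≤ 1)
    (hM : ∀ u : En n, ‖u‖ = 1 → |MvPolynomial.eval (fun j => u j) p| ≤ M) (hM0 : 0 ≤ M) :
    IsUBound γ M fun u => MvPolynomial.eval (fun j => u j) p where
  meas := (IsBddMeas.eval p).meas
  mem := by
    refine ⟨hM, fun k hk => ⟨p, hp.trans hk, ?_⟩⟩
    simp only [sub_self, sphL2]
    norm_num
    positivity

lemma one : IsUBound γ 1 fun _ : En n => 1 := by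
  simpa using of_eval (n := n) (γ := γ) (p := 1) (by simp) (M := 1) (by simp) zero_le_one

lemma zero : IsUBound γ 0 fun _ : En n => 0 := by
  simpa using of_eval (n := n) (γ := γ) (p := 0) (by simp) (M := 0) (by simp) le_rfl

lemma coord (j : Fin n) : IsUBound γ 1 fun u : En n => u j := by
  simpa using of_eval (n := n) (γ := γ) (p := MvPolynomial.X j) (by simp) (M := 1)
    (fun u hu => by simpa [hu] using PiLp.norm_apply_le u j) zero_le_one

lemma const_mul (c : ℝ) (h : IsUBound γ M f) : IsUBound γ (|c| * M) fun u => c * f u where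
  meas := h.meas.const_mul c
  mem := by
    refine ⟨fun u hu => ?_, fun k hk => ?_⟩
    · rw [abs_mul]
      exact mul_le_mul_of_nonneg_left (h.mem.1 u hu) (abs_nonneg c)
    · obtain ⟨p, hp, hpe⟩ := h.mem.2 k hk
      refine ⟨MvPolynomial.C c * p, (MvPolynomial.totalDegree_mul _ _).trans (by simpa), ?_⟩
      rw [mul_assoc]
      refine le_trans (le_trans (le_of_eq (sphL2_congr fun u => ?_)) <|
        sphL2_mul_le (f := fun _ => c) (abs_nonneg c) (fun _ => le_rfl)
          (h.isBddMeas.sub (IsBddMeas.eval p))) (mul_le_mul_of_nonneg_left hpe (abs_nonneg c))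
      simp [mul_sub]

lemma add (hf : IsUBound γ M f) (hg : IsUBound γ N g) :
    IsUBound γ (M + N) fun u => f u + g u where
  meas := hf.meas.add hg.meas
  mem := by
    refine ⟨fun u hu => (abs_add_le _ _).trans (add_le_add (hf.mem.1 u hu) (hg.mem.1 u hu)),
      fun k hk => ?_⟩
    obtain ⟨p, hp, hpe⟩ := hf.mem.2 k hk
    obtain ⟨q, hq, hqe⟩ := hg.mem.2 k hk
    refine ⟨p + q, (MvPolynomial.totalDegree_add _ _).trans (max_le hp hq), ?_⟩
    rw [add_mul]
    refine le_trans (le_trans (le_of_eq (sphL2_congr fun u => ?_)) <|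
      sphL2_add_le (hf.isBddMeas.sub (IsBddMeas.eval p)) (hg.isBddMeas.sub (IsBddMeas.eval q)))
      (add_le_add hpe hqe)
    simp only [map_add]
    ring

lemma sum {ι : Type*} (s : Finset ι) {F : ι → En n → ℝ} {M : ι → ℝ}
    (h : ∀ i ∈ s, IsUBound γ (M i) (F i)) :
    IsUBound γ (∑ i ∈ s, M i) fun u => ∑ i ∈ s, F i u := by
  classical
  induction s using Finset.induction_on with
  | empty => simpa using zero
  | insert i s hi ih =>
    simp only [Finset.sum_insert hi]
    exact (h i (Finset.mem_insert_self i s)).add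
      (ih fun j hj => h j (Finset.mem_insert_of_mem hj))

end IsUBound

/-- Up to a constant, the norm of `𝒰_γ` is submultiplicative. -/
lemma exists_isUBound_mul {m : ℕ} (hm : 0 < m) {γ : ℝ} (hγ : 0 ≤ γ) :
    ∃ K : ℝ, 0 < K ∧ ∀ (f g : En (m + 1) → ℝ) (M N : ℝ), IsUBound γ M f → IsUBound γ N g →
      IsUBound γ (K * (M * N)) fun u => f u * g u := by
  obtain ⟨D, hD0, hD⟩ := exists_bounded_approx hm
  set ω := Real.sqrt ((sphVol (m + 1)).real Set.univ)
  have hω : 0 ≤ ω := Real.sqrt_nonneg _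
  have h8 : (1 : ℝ) ≤ (8 : ℕ) ^ γ := Real.one_le_rpow (by norm_num) hγ
  refine ⟨(1 + 2 * D + ω) * (8 : ℕ) ^ γ, by positivity, fun f g M N hf hg =>
    ⟨hf.meas.mul hg.meas, fun u hu => ?_, fun k hk => ?_⟩⟩
  · have hM := nonneg_of_mem_UBounds hf.mem
    have hN := nonneg_of_mem_UBounds hg.mem
    rw [abs_mul]
    calc |f u| * |g u| ≤ 1 * (M * N) := by
          rw [one_mul]
          exact mul_le_mul (hf.mem.1 u hu) (hg.mem.1 u hu) (abs_nonneg _) hM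
      _ ≤ _ := by
          refine mul_le_mul_of_nonneg_right ?_ (by positivity)
          nlinarith
  have hM := nonneg_of_mem_UBounds hf.mem
  have hN := nonneg_of_mem_UBounds hg.mem
  rcases lt_or_ge k 4 with hk4 | hk4
  · refine ⟨0, by simp, ?_⟩
    have h1 : sphL2 (fun x : En (m + 1) => f x * g x) ≤ M * N * ω := by
      calc _ ≤ M * sphL2 g := sphL2_mul_le hM hf.abs_le hg.isBddMeas
        _ ≤ M * (N * ω) := by
            refine mul_le_mul_of_nonneg_left ?_ hM
            simpa [sphL2_one] using sphL2_mul_le hN hg.abs_le (IsBddMeas.const (n := m + 1) 1)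
        _ = _ := by ring
    have h2 := rpow_neg_le_mul hγ (c := 8) (i := 1) hk (by norm_num) (by omega)
    rw [Nat.cast_one, Real.one_rpow] at h2
    simp only [map_zero, sub_zero]
    calc _ ≤ M * N * ω := h1
      _ ≤ M * N * (1 + 2 * D + ω) * 1 := by
          rw [mul_one]
          exact mul_le_mul_of_nonneg_left (by linarith) (by positivity)
      _ ≤ M * N * (1 + 2 * D + ω) * ((8 : ℕ) ^ γ * (k : ℝ) ^ (-γ)) :=
          mul_le_mul_of_nonneg_left h2 (by positivity)
      _ = _ := by ring
  · obtain ⟨V, hVdeg, hVbd, hV⟩ := hD (k / 4) f M hf.meas hM hf.abs_le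
    have hi : 0 < k / 4 := by omega
    obtain ⟨p, hp, hpe⟩ := hf.mem.2 _ hi
    obtain ⟨q, hq, hqe⟩ := hg.mem.2 _ hi
    refine ⟨V * q, (MvPolynomial.totalDegree_mul _ _).trans (by omega), ?_⟩
    have h1 := sphL2_mul_le (f := fun x => MvPolynomial.eval (fun j => x j) V)
      (mul_nonneg hD0 hM) hVbd (hg.isBddMeas.sub (IsBddMeas.eval q))
    have h2 := sphL2_mul_le hN hg.abs_le (hf.isBddMeas.sub (IsBddMeas.eval V))
    have h3 := sphL2_add_le ((IsBddMeas.eval V).mul (hg.isBddMeas.sub (IsBddMeas.eval q)))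
      (hg.isBddMeas.mul (hf.isBddMeas.sub (IsBddMeas.eval V)))
    have h4 := rpow_neg_le_mul hγ (c := 8) (i := k / 4) hk (by norm_num) (by omega)
    have h5 := (hV p hp).trans (mul_le_mul_of_nonneg_left hpe (by positivity))
    have hiγ : (0 : ℝ) ≤ ((k / 4 : ℕ) : ℝ) ^ (-γ) := by positivity
    calc _ ≤ _ := (sphL2_congr fun u => by simp only [map_mul]; ring).trans_le h3
      _ ≤ D * M * (N * ((k / 4 : ℕ) : ℝ) ^ (-γ)) +
          N * ((1 + D) * (M * ((k / 4 : ℕ) : ℝ) ^ (-γ))) :=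
          add_le_add (h1.trans (mul_le_mul_of_nonneg_left hqe (by positivity)))
            (h2.trans (mul_le_mul_of_nonneg_left h5 hN))
      _ = M * N * (1 + 2 * D) * ((k / 4 : ℕ) : ℝ) ^ (-γ) := by ring
      _ ≤ M * N * (1 + 2 * D + ω) * ((8 : ℕ) ^ γ * (k : ℝ) ^ (-γ)) := by
          refine mul_le_mul (mul_le_mul_of_nonneg_left (by linarith) (by positivity)) h4 hiγ
            (by positivity)
      _ = _ := by ring

lemma IsUBound.prod {γ K : ℝ}
    (hK : ∀ (f g : En n → ℝ) (M N : ℝ), IsUBound γ M f → IsUBound γ N g →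
      IsUBound γ (K * (M * N)) fun u => f u * g u)
    {ι : Type*} (s : Finset ι) {F : ι → En n → ℝ} {M : ι → ℝ}
    (h : ∀ i ∈ s, IsUBound γ (M i) (F i)) :
    IsUBound γ (K ^ s.card * ∏ i ∈ s, M i) fun u => ∏ i ∈ s, F i u := by
  classical
  induction s using Finset.induction_on with
  | empty => simpa using IsUBound.one
  | insert i s hi ih =>
    simp only [Finset.prod_insert hi, Finset.card_insert_of_notMem hi]
    convert hK _ _ _ _ (h i (Finset.mem_insert_self i s))
      (ih fun j hj => h j (Finset.mem_insert_of_mem hj)) using 1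
    ring

end ProductEstimate

section MixedDiscriminant

lemma sum_powerset_neg_one_pow_card_mul_prod_sum {m : ℕ} (a : Fin m → Fin m → ℝ) :
    ∑ S : Finset (Fin m), (-1 : ℝ) ^ (m - S.card) * ∏ i, ∑ k ∈ S, a i k =
      ∑ τ : Equiv.Perm (Fin m), ∏ i, a i (τ i) := by
  have h1 (S : Finset (Fin m)) : ∏ i, ∑ k ∈ S, a i k =
      ∑ φ : Fin m → Fin m, if Finset.univ.image φ ⊆ S then ∏ i, a i (φ i) else 0 := by
    rw [Finset.prod_univ_sum, ← Finset.sum_filter]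
    refine Finset.sum_congr ?_ fun _ _ => rfl
    ext φ
    simp [Fintype.mem_piFinset, Finset.image_subset_iff]
  have h2 (T : Finset (Fin m)) :
      ∑ S : Finset (Fin m), (if T ⊆ S then (-1 : ℝ) ^ (m - S.card) else 0) =
        if T = Finset.univ then 1 else 0 := by
    rw [← (compl_bijective (α := Finset (Fin m))).sum_comp]
    have h3 (S : Finset (Fin m)) : m - (Sᶜ).card = S.card := by
      rw [Finset.card_compl, Fintype.card_fin]
      have := Finset.card_le_univ S
      rw [Fintype.card_fin] at this
      omega
    have h4 : (Finset.univ.filter fun S : Finset (Fin m) => T ⊆ Sᶜ) = Tᶜ.powerset := by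
      ext S
      simp [Finset.subset_compl_comm]
    simp only [h3, ← Finset.sum_filter, h4]
    have h5 := congrArg (Int.cast : ℤ → ℝ) (Finset.sum_powerset_neg_one_pow_card (x := Tᶜ))
    push_cast at h5
    rw [h5]
    simp
  simp_rw [h1, Finset.mul_sum]
  rw [Finset.sum_comm]
  have h6 (φ : Fin m → Fin m) : ∑ S : Finset (Fin m), (-1 : ℝ) ^ (m - S.card) *
      (if Finset.univ.image φ ⊆ S then ∏ i, a i (φ i) else 0) =
      if Finset.univ.image φ = Finset.univ then ∏ i, a i (φ i) else 0 := by
    have := congrArg (· * ∏ i, a i (φ i)) (h2 (Finset.univ.image φ))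
    simpa [Finset.sum_mul, ite_mul] using this
  simp_rw [h6]
  symm
  refine Fintype.sum_of_injective (fun τ : Equiv.Perm (Fin m) => (τ : Fin m → Fin m))
    DFunLike.coe_injective _ _ (fun φ hφ => ?_) fun τ => ?_
  · refine if_neg fun h => hφ ?_
    have hs : Function.Surjective φ := fun y => by simpa using h.ge (Finset.mem_univ y)
    exact ⟨Equiv.ofBijective φ (Finite.surjective_iff_bijective.1 hs), rfl⟩
  · rw [if_pos (Finset.image_univ_equiv τ)]

lemma mixedDisc_eq_sum {m : ℕ} (A : Fin m → Matrix (Fin m) (Fin m) ℝ) :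
    mixedDisc A = (m.factorial : ℝ)⁻¹ * ∑ σ : Equiv.Perm (Fin m), ∑ τ : Equiv.Perm (Fin m),
      (Equiv.Perm.sign σ : ℝ) * ∏ i, A (τ i) (σ i) i := by
  simp only [mixedDisc, Matrix.det_apply', Matrix.sum_apply]
  congr 1
  simp_rw [Finset.mul_sum]
  rw [Finset.sum_comm]
  refine Finset.sum_congr rfl fun σ _ => ?_
  rw [← Finset.mul_sum, ← sum_powerset_neg_one_pow_card_mul_prod_sum fun i k => A k (σ i) i,
    Finset.mul_sum]
  refine Finset.sum_congr rfl fun S _ => ?_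
  ring

lemma measurable_hessE (F : En n → ℝ) (j l : Fin n) : Measurable fun u => hessE F u j l := by
  simp only [hessE, iteratedFDeriv_two_apply]
  borelize (En n →L[ℝ] ℝ)
  exact (ContinuousLinearMap.measurable_apply _).comp (measurable_fderiv_apply_const ℝ _ _)

/-- The mixed discriminant is multilinear and continuous with respect to `𝒰_γ`. -/
lemma exists_isUBound_mixedDisc {m : ℕ} (hm : 0 < m) {γ : ℝ} (hγ : 0 ≤ γ) :
    ∃ K : ℝ, 0 < K ∧ ∀ (A : En (m + 1) → Fin (m + 1) → Matrix (Fin (m + 1)) (Fin (m + 1)) ℝ)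
      (M : Fin (m + 1) → ℝ), (∀ k i j, IsUBound γ (M k) fun u => A u k i j) →
      IsUBound γ (K * ∏ k, M k) fun u => mixedDisc (A u) := by
  obtain ⟨K, hK, hmul⟩ := exists_isUBound_mul hm hγ
  set c : ℝ := (Fintype.card (Equiv.Perm (Fin (m + 1))) : ℝ)
  have hc : 0 < c := Nat.cast_pos.2 Fintype.card_pos
  refine ⟨((m + 1).factorial : ℝ)⁻¹ * c * c * K ^ (m + 1), by positivity, fun A M hA => ?_⟩
  simp only [mixedDisc_eq_sum]
  have hterm (σ τ : Equiv.Perm (Fin (m + 1))) :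
      IsUBound γ (K ^ (m + 1) * ∏ k, M k)
        fun u => (Equiv.Perm.sign σ : ℝ) * ∏ i, A u (τ i) (σ i) i := by
    have h1 := (IsUBound.prod hmul Finset.univ fun i _ => hA (τ i) (σ i) i).const_mul
      (Equiv.Perm.sign σ : ℝ)
    rw [Equiv.prod_comp τ M, Finset.card_univ, Fintype.card_fin] at h1
    refine h1.mono (le_of_eq ?_)
    rcases Int.units_eq_one_or (Equiv.Perm.sign σ) with h | h <;> simp [h]
  have := (IsUBound.sum Finset.univ fun σ _ =>
    IsUBound.sum Finset.univ fun τ _ => hterm σ τ).const_mul ((m + 1).factorial : ℝ)⁻¹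
  refine this.mono (le_of_eq ?_)
  simp only [Finset.sum_const, nsmul_eq_mul, Finset.card_univ]
  rw [abs_of_pos (by positivity)]
  ring

end MixedDiscriminant

/-- **Lemma 3.6.** If the Hessian entries of `T_g` map `𝒰_α` boundedly to
`𝒰_{α+β}`, then so does the mixed discriminant of the Hessians, multilinearly. -/
theorem mixed_discriminant_U_bound
    (n : ℕ) (hn : 3 ≤ n) (α : ℝ) (hα : 0 ≤ α)
    (g : ℝ → ℝ) (hg : ContDiffOn ℝ 2 g (Set.Icc (-1) 1))
    (β : ℝ) (hβ : 0 < β) (C : ℝ) (hC : 0 < C)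
    (hyp : ∀ f : En n → ℝ, MemU α f → ∀ j l : Fin n,
      C * UNorm α f ∈ UBounds (α + β) (fun u => hessE (Tg g f) u j l)) :
    ∃ C' > (0 : ℝ), ∀ f : Fin (n - 1) → (En n → ℝ), (∀ k, MemU α (f k)) →
      MemU (α + β) (fun u => restrDisc u fun k => hessMat (Tg g (f k)) u) ∧
      UNorm (α + β) (fun u => restrDisc u fun k => hessMat (Tg g (f k)) u) ≤
        C' * ∏ k, UNorm α (f k) := by
  obtain ⟨m, rfl⟩ : ∃ m, n = m + 1 := ⟨n - 1, by omega⟩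
  have hm : 0 < m := by omega
  have hγ : 0 ≤ α + β := by linarith
  obtain ⟨K, hK, hmul⟩ := exists_isUBound_mul hm hγ
  obtain ⟨L, hL, hdisc⟩ := exists_isUBound_mixedDisc hm hγ
  refine ⟨|((m + 1 : ℕ) : ℝ)| * (L * (K * C ^ m)), by positivity, fun f hf => ?_⟩
  have key : |((m + 1 : ℕ) : ℝ)| * (L * (K * C ^ m)) * ∏ k, UNorm α (f k) ∈
      UBounds (α + β) (fun u => restrDisc u fun k => hessMat (Tg g (f k)) u) := by
    let M : Fin (m + 1) → ℝ := Fin.cons K fun i : Fin m => C * UNorm α (f i)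
    have hprod : ∏ k, M k = K * C ^ m * ∏ k : Fin m, UNorm α (f k) := by
      simp [M, Fin.prod_univ_succ, Finset.prod_mul_distrib, mul_assoc]
    have hentry (k i j : Fin (m + 1)) : IsUBound (α + β) (M k) fun u =>
        (if h : (k : ℕ) = 0 then outer u else
          hessMat (Tg g (f ⟨(k : ℕ) - 1, by have := k.isLt; omega⟩)) u :
          Matrix (Fin (m + 1)) (Fin (m + 1)) ℝ) i j := by
      cases k using Fin.cases with
      | zero => simpa [M, outer] using hmul _ _ _ _ (IsUBound.coord i) (IsUBound.coord j)
      | succ k =>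
        refine ⟨?_, ?_⟩
        · exact ((measurable_hessE (Tg g (f k)) i j).comp
            measurable_subtype_coe).aestronglyMeasurable
        · simpa [M, hessMat] using hyp (f k) (hf k) i j
    have h := (((hdisc _ M hentry).const_mul ((m + 1 : ℕ) : ℝ))).mem
    rw [hprod, ← mul_assoc L, ← mul_assoc |_|] at h
    exact h
  exact ⟨⟨_, key⟩, csInf_le ⟨0, fun _ h => nonneg_of_mem_UBounds h⟩ key⟩

end MinkIter
end
end
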